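/- Let k ≥ 3 and t ≥ 1 be integers. There exists n₀ such that for all n ≥ n₀, the maximum number of edges in a k-uniform hypergraph on n vertices containing no k-uniform linear path of length 2t+1 is exactly C(n−1,k−1) + C(n−2,k−1) + … + C(n−t,k−1). -/

import Mathlib

/-- A `k`-uniform linear path of length `ℓ`: a list of `k`-sets `F₁, …, F_ℓ` such that
`|F_i ∩ F_{i+1}| = 1` for consecutive sets and `F_i ∩ F_j = ∅` whenever `|i - j| > 1`. -/
def IsLinearPath (k ℓ : ℕ) {n : ℕ} (A : Fin ℓ → Finset (Fin n)) : Prop :=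
  (∀ i, (A i).card = k) ∧
  (∀ i j : Fin ℓ, (j : ℕ) = (i : ℕ) + 1 → (A i ∩ A j).card = 1) ∧
  (∀ i j : Fin ℓ, (i : ℕ) + 1 < (j : ℕ) → Disjoint (A i) (A j))

/-- `LinearChain H ℓ U x`: there is a linear path of `ℓ` edges of `H` with union `U`, starting from
a distinguished vertex, such that `x` is a vertex of the last edge lying in no earlier edge. -/
inductive LinearChain {V : Type*} [DecidableEq V] (H : Finset (Finset V)) :
    ℕ → Finset V → V → Prop
  | start (x : V) : LinearChain H 0 {x} x
  | step {ℓ : ℕ} {U e : Finset V} {x y : V} (hc : LinearChain H ℓ U x) (he : e ∈ H)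
      (hU : e ∩ U = {x}) (hy : y ∈ e) (hyx : y ≠ x) : LinearChain H (ℓ + 1) (U ∪ e) y

namespace LinearChain

variable {V : Type*} [DecidableEq V] {H : Finset (Finset V)} {ℓ k : ℕ} {U : Finset V} {x : V}

theorem mem (h : LinearChain H ℓ U x) : x ∈ U := by
  cases h with
  | start => simp
  | step hc he hU hy hyx => exact Finset.mem_union_right _ hy

theorem card_le (h : LinearChain H ℓ U x) (hk : ∀ e ∈ H, e.card = k) :
    U.card ≤ ℓ * k + 1 := by
  induction h with
  | start => simp
  | @step ℓ U e x y hc he hU hy hyx ih =>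
    have h1 := Finset.card_union_add_card_inter U e
    rw [Finset.inter_comm, hU, Finset.card_singleton, hk e he] at h1
    rw [add_mul]
    omega

theorem exists_pred (h : LinearChain H (ℓ + 1) U x) : ∃ U' x', LinearChain H ℓ U' x' := by
  cases h with
  | step hc he hU hy hyx => exact ⟨_, _, hc⟩

/-- A set meeting `U` in at most `x` extends the chain. -/
theorem extend (h : LinearChain H ℓ U x) {e : Finset V} {y : V} (he : e ∈ H) (hx : x ∈ e)
    (hd : Disjoint e (U.erase x)) (hy : y ∈ e) (hyx : y ≠ x) :
    LinearChain H (ℓ + 1) (U ∪ e) y := by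
  refine h.step he ?_ hy hyx
  ext z
  simp only [Finset.mem_inter, Finset.mem_singleton]
  constructor
  · rintro ⟨hz, hzU⟩
    by_contra hne
    exact Finset.disjoint_left.1 hd hz (Finset.mem_erase.2 ⟨hne, hzU⟩)
  · rintro rfl
    exact ⟨hx, h.mem⟩

end LinearChain

theorem LinearChain.exists_isLinearPath {n k ℓ : ℕ} {H : Finset (Finset (Fin n))}
    {U : Finset (Fin n)} {x : Fin n} (h : LinearChain H ℓ U x) (hk : ∀ e ∈ H, e.card = k) :
    ∃ A : Fin ℓ → Finset (Fin n), IsLinearPath k ℓ A ∧ (∀ i, A i ∈ H) ∧ (∀ i, A i ⊆ U) ∧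
      ∀ i, x ∈ A i ↔ (i : ℕ) + 1 = ℓ := by
  induction h with
  | start x => exact ⟨fun i => i.elim0, ⟨fun i => i.elim0, fun i => i.elim0, fun i => i.elim0⟩,
      fun i => i.elim0, fun i => i.elim0, fun i => i.elim0⟩
  | @step ℓ U e x y hc he hU hy hyx ih =>
    obtain ⟨A, ⟨-, hA2, hA3⟩, hAH, hAU, hAx⟩ := ih
    have hAe : ∀ i, A i ∩ e ⊆ {x} := fun i => by
      rw [← hU, Finset.inter_comm]
      exact Finset.inter_subset_inter_left (hAU i)
    have hxe : x ∈ e := (Finset.mem_inter.1 (hU ▸ Finset.mem_singleton_self x)).1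
    have hyU : y ∉ U := fun hyU => hyx (by
      rw [← Finset.mem_singleton, ← hU]
      exact Finset.mem_inter.2 ⟨hy, hyU⟩)
    have hmem : ∀ i, Fin.snoc (α := fun _ => Finset (Fin n)) A e i ∈ H := by
      intro i
      induction i using Fin.lastCases with
      | last => simpa using he
      | cast i => simpa using hAH i
    refine ⟨Fin.snoc (α := fun _ => Finset (Fin n)) A e, ⟨fun i => hk _ (hmem i), ?_, ?_⟩,
      hmem, ?_, ?_⟩
    · intro i j hij
      induction j using Fin.lastCases with
      | last =>
        induction i using Fin.lastCases with
        | last => simp at hij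
        | cast i =>
          simp only [Fin.snoc_castSucc, Fin.snoc_last]
          simp only [Fin.val_last, Fin.val_castSucc] at hij
          rw [Finset.card_eq_one]
          refine ⟨x, (hAe i).antisymm ?_⟩
          rw [Finset.singleton_subset_iff, Finset.mem_inter]
          exact ⟨(hAx i).2 hij.symm, hxe⟩
      | cast j =>
        induction i using Fin.lastCases with
        | last => have := j.2; simp at hij; omega
        | cast i =>
          simp only [Fin.snoc_castSucc]
          exact hA2 i j (by simpa using hij)
    · intro i j hij
      induction j using Fin.lastCases with
      | last =>
        induction i using Fin.lastCases with
        | last => simp at hij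
        | cast i =>
          simp only [Fin.snoc_castSucc, Fin.snoc_last]
          simp only [Fin.val_last, Fin.val_castSucc] at hij
          rw [Finset.disjoint_left]
          intro z hz hze
          have hzx := Finset.mem_singleton.1 (hAe i (Finset.mem_inter.2 ⟨hz, hze⟩))
          subst hzx
          have := (hAx i).1 hz
          omega
      | cast j =>
        induction i using Fin.lastCases with
        | last => have := j.2; simp at hij; omega
        | cast i =>
          simp only [Fin.snoc_castSucc]
          exact hA3 i j (by simpa using hij)
    · intro i
      induction i using Fin.lastCases with
      | last => simp
      | cast i =>
        simp only [Fin.snoc_castSucc]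
        exact (hAU i).trans Finset.subset_union_left
    · intro i
      induction i using Fin.lastCases with
      | last => simpa using hy
      | cast i =>
        simp only [Fin.snoc_castSucc, Fin.val_castSucc]
        constructor
        · exact fun h => absurd (hAU i h) hyU
        · intro h
          have := i.2
          omega

/-- A `c`-uniform family on `W` each of whose members contains one of the `s`-sets of `P`. -/
theorem card_le_of_exists_subset {V : Type*} [DecidableEq V] {P E : Finset (Finset V)}
    {W : Finset V} {c s : ℕ} (hE : ∀ e ∈ E, e.card = c) (hW : ∀ e ∈ E, e ⊆ W)
    (hP : ∀ q ∈ P, q.card = s) (h : ∀ e ∈ E, ∃ q ∈ P, q ⊆ e) :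
    E.card ≤ P.card * W.card ^ (c - s) := by
  have hsub : E ⊆ P.biUnion fun q => (W.powersetCard (c - s)).image (q ∪ ·) := by
    intro e he
    obtain ⟨q, hq, hqe⟩ := h e he
    simp only [Finset.mem_biUnion, Finset.mem_image, Finset.mem_powersetCard]
    refine ⟨q, hq, e \ q, ⟨Finset.sdiff_subset.trans (hW e he), ?_⟩,
      Finset.union_sdiff_of_subset hqe⟩
    rw [Finset.card_sdiff_of_subset hqe, hE e he, hP q hq]
  refine (Finset.card_le_card hsub).trans (Finset.card_biUnion_le_card_mul _ _ _ fun q _ => ?_)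
  refine Finset.card_image_le.trans ?_
  rw [Finset.card_powersetCard]
  exact Nat.choose_le_pow _ _

/-- If every nonempty set has a removable vertex, the vertices can be ordered so that each of them
is removable from the set of vertices that do not precede it. -/
theorem exists_elimination_order {V β : Type*} [DecidableEq V] [Nonempty β]
    (P : V → β → Set V → Prop) (Λ : Finset V)
    (h : ∀ S : Finset V, S.Nonempty → S ⊆ Λ → ∃ v ∈ S, ∃ b, P v b ↑S) :
    ∃ (r : V → ℕ) (f : V → β), Set.InjOn r Λ ∧
      ∀ v ∈ Λ, P v (f v) {u | u ∈ Λ ∧ r v ≤ r u} := by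
  induction hn : Λ.card generalizing Λ with
  | zero =>
    rw [Finset.card_eq_zero] at hn
    subst hn
    exact ⟨fun _ => 0, fun _ => Classical.arbitrary β, by simp, by simp⟩
  | succ n ih =>
    have hne : Λ.Nonempty := Finset.card_pos.1 (by omega)
    obtain ⟨v, hv, b, hb⟩ := h Λ hne subset_rfl
    obtain ⟨r, f, hr, hf⟩ := ih (Λ.erase v)
      (fun S hS hSΛ => h S hS (hSΛ.trans (Finset.erase_subset _ _)))
      (by rw [Finset.card_erase_of_mem hv, hn]; rfl)
    refine ⟨fun u => if u = v then 0 else r u + 1, fun u => if u = v then b else f u, ?_, ?_⟩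
    · intro a ha c hc hac
      by_cases hav : a = v <;> by_cases hcv : c = v <;> simp [hav, hcv] at hac ⊢
      exact hr (by simp [hav]; exact ha) (by simp [hcv]; exact hc) hac
    · intro u hu
      by_cases huv : u = v
      · subst huv
        convert hb using 1
        · simp
        · ext z
          simp
      · have h1 := hf u (Finset.mem_erase.2 ⟨huv, hu⟩)
        simp only [huv, if_false]
        convert h1 using 1
        ext z
        by_cases hzv : z = v <;> simp [hzv]

/-- An ordering `r` of the vertices with sets `F v` of at most `N` obstacles, such that from `v` no
later vertex can be reached through one edge, or through two edges sharing one vertex,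
avoiding `F v`. -/
structure IsElimination {V : Type*} [DecidableEq V] (H : Finset (Finset V)) (N : ℕ)
    (r : V → ℕ) (F : V → Finset V) : Prop where
  inj : Function.Injective r
  card_le : ∀ v, (F v).card ≤ N
  notMem : ∀ v, v ∉ F v
  one_step : ∀ v, ∀ e ∈ H, v ∈ e → Disjoint e (F v) → ∀ v' ∈ e, v' ≠ v → ¬ r v ≤ r v'
  two_step : ∀ v, ∀ e ∈ H, ∀ e' ∈ H, ∀ u, v ∈ e → e ∩ e' = {u} → u ≠ v → Disjoint e (F v) →
    Disjoint e' (F v) → ∀ v' ∈ e', v' ≠ u → ¬ r v ≤ r v'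

theorem exists_isElimination {V : Type*} [DecidableEq V] [Fintype V] {H : Finset (Finset V)}
    {k ℓ N : ℕ} (hk : ∀ e ∈ H, e.card = k) (hN : (ℓ + 1) * k ≤ N)
    (hfree : ∀ U x, ¬ LinearChain H ℓ U x) :
    ∃ r F, IsElimination H N r F := by
  obtain ⟨r, F, hr, hF⟩ := exists_elimination_order
    (fun (v : V) (F : Finset V) (S : Set V) => F.card ≤ N ∧ v ∉ F ∧
      (∀ e ∈ H, v ∈ e → Disjoint e F → ∀ v' ∈ e, v' ≠ v → v' ∉ S) ∧
      (∀ e ∈ H, ∀ e' ∈ H, ∀ u, v ∈ e → e ∩ e' = {u} → u ≠ v → Disjoint e F → Disjoint e' F →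
        ∀ v' ∈ e', v' ≠ u → v' ∉ S)) Finset.univ (by
    intro S hS _
    by_contra! hcon
    have key : ∀ m ≤ ℓ, ∃ m', (m' = m ∨ m' = m + 1) ∧ ∃ U, ∃ v ∈ S, LinearChain H m' U v := by
      intro m
      induction m with
      | zero =>
        intro _
        obtain ⟨v, hv⟩ := hS
        exact ⟨0, Or.inl rfl, {v}, v, hv, .start v⟩
      | succ m ih =>
        intro hm
        obtain ⟨m', hm', U, v, hv, hc⟩ := ih (by omega)
        rcases hm' with rfl | rfl
        swap
        · exact ⟨m + 1, Or.inl rfl, U, v, hv, hc⟩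
        have hcard : (U.erase v).card ≤ N := by
          have h1 := hc.card_le hk
          rw [Finset.card_erase_of_mem hc.mem]
          have h2 : m' * k ≤ (ℓ + 1) * k := Nat.mul_le_mul_right _ (by omega)
          omega
        by_cases h1 : ∀ e ∈ H, v ∈ e → Disjoint e (U.erase v) → ∀ v' ∈ e, v' ≠ v → v' ∉ (S : Set V)
        · obtain ⟨e, he, e', he', u, hve, hee, huv, hd, hd', v', hv', hvu, hvS⟩ :=
            hcon v hv (U.erase v) hcard (by simp) h1
          have hue : u ∈ e ∩ e' := hee ▸ Finset.mem_singleton_self u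
          rw [Finset.mem_inter] at hue
          have hc' := hc.extend he hve hd hue.1 huv
          refine ⟨m' + 2, Or.inr rfl, _, v', hvS, hc'.extend he' hue.2 ?_ hv' hvu⟩
          rw [Finset.disjoint_left]
          intro z hz hzU
          rw [Finset.mem_erase, Finset.mem_union] at hzU
          rcases hzU with ⟨hzu, hzU | hze⟩
          · by_cases hzv : z = v
            · subst hzv
              apply hzu
              rw [← Finset.mem_singleton, ← hee]
              exact Finset.mem_inter.2 ⟨hve, hz⟩
            · exact Finset.disjoint_left.1 hd' hz (Finset.mem_erase.2 ⟨hzv, hzU⟩)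
          · apply hzu
            rw [← Finset.mem_singleton, ← hee]
            exact Finset.mem_inter.2 ⟨hze, hz⟩
        · push Not at h1
          obtain ⟨e, he, hve, hd, v', hv', hvv, hvS⟩ := h1
          exact ⟨m' + 1, Or.inl rfl, _, v', hvS, hc.extend he hve hd hv' hvv⟩
    obtain ⟨m', hm', U, v, -, hc⟩ := key ℓ le_rfl
    rcases hm' with rfl | rfl
    · exact hfree _ _ hc
    · obtain ⟨U', x', h⟩ := hc.exists_pred
      exact hfree _ _ h)
  refine ⟨r, F, fun a b h => hr (by simp) (by simp) h, fun v => (hF v (by simp)).1,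
    fun v => (hF v (by simp)).2.1, ?_, ?_⟩
  · intro v e he hve hd v' hv' hne hle
    exact (hF v (by simp)).2.2.1 e he hve hd v' hv' hne ⟨by simp, hle⟩
  · intro v e he e' he' u hve hee huv hd hd' v' hv' hne hle
    exact (hF v (by simp)).2.2.2 e he e' he' u hve hee huv hd hd' v' hv' hne ⟨by simp, hle⟩

namespace IsElimination

variable {V : Type*} [DecidableEq V] {H : Finset (Finset V)} {N : ℕ} {r : V → ℕ}
  {F : V → Finset V}

theorem exists_arc (hE : IsElimination H N r F) {e : Finset V} (he : e ∈ H) {v u : V}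
    (hv : v ∈ e) (hu : u ∈ e) (hvu : r v < r u) : ∃ w ∈ e, w ∈ F v ∧ w ≠ v := by
  have h : ¬ Disjoint e (F v) := fun hd =>
    hE.one_step v e he hv hd u hu (by rintro rfl; exact lt_irrefl _ hvu) hvu.le
  obtain ⟨w, hw, hwF⟩ := Finset.not_disjoint_iff.1 h
  exact ⟨w, hw, hwF, by rintro rfl; exact hE.notMem w hwF⟩

/-- The crude upper bound on the number of edges. -/
theorem card_le_mul_pow (hE : IsElimination H N r F) {k : ℕ} {B : Finset (Finset V)}
    {W : Finset V} (hB : B ⊆ H) (hk : ∀ e ∈ H, e.card = k + 2) (hW : ∀ e ∈ B, e ⊆ W) :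
    B.card ≤ N * W.card ^ (k + 1) := by
  set P : Finset (Finset V) := (W.biUnion fun a => (F a).image fun b => {a, b}).filter
    fun q => q.card = 2
  have hP : P.card ≤ W.card * N :=
    (Finset.card_filter_le _ _).trans <| Finset.card_biUnion_le_card_mul _ _ _ fun a _ =>
      Finset.card_image_le.trans (hE.card_le a)
  have h := card_le_of_exists_subset (P := P) (E := B) (W := W) (c := k + 2) (s := 2)
    (fun e he => hk e (hB he)) hW (fun q hq => (Finset.mem_filter.1 hq).2) (by
      intro e he
      have hek := hk e (hB he)
      obtain ⟨a, ha, hmin⟩ := e.exists_min_image r (Finset.card_pos.1 (by omega))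
      obtain ⟨b, hb, hba⟩ := Finset.exists_mem_ne (by omega : 1 < e.card) a
      have hlt : r a < r b := lt_of_le_of_ne (hmin b hb) fun h => hba (hE.inj h.symm)
      obtain ⟨w, hw, hwF, hwa⟩ := hE.exists_arc (hB he) ha hb hlt
      refine ⟨{a, w}, Finset.mem_filter.2 ⟨?_, Finset.card_pair hwa.symm⟩, ?_⟩
      · exact Finset.mem_biUnion.2 ⟨a, hW e he ha, Finset.mem_image_of_mem _ hwF⟩
      · intro z hz
        simp only [Finset.mem_insert, Finset.mem_singleton] at hz
        rcases hz with rfl | rfl <;> assumption)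
  calc B.card ≤ P.card * W.card ^ k := h
    _ ≤ W.card * N * W.card ^ k := Nat.mul_le_mul_right _ hP
    _ = N * W.card ^ (k + 1) := by ring

end IsElimination

/-- The sets of size `c` disjoint from `A` that form an edge of `H` with each vertex of `A`. -/
def commonLink {V : Type*} [DecidableEq V] [Fintype V] (H : Finset (Finset V)) (A : Finset V)
    (c : ℕ) : Finset (Finset V) :=
  (Finset.powersetCard c (Finset.univ \ A)).filter fun p => ∀ s ∈ A, insert s p ∈ H

/-- The vertices outside `A` lying in more than `d` members of the common link of `A`. -/
def linkCore {V : Type*} [DecidableEq V] [Fintype V] (H : Finset (Finset V)) (A : Finset V)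
    (c d : ℕ) : Finset V :=
  (Finset.univ \ A).filter fun x => d < ((commonLink H A c).filter (x ∈ ·)).card

section LinkCore

variable {V : Type*} [DecidableEq V] [Fintype V] {H : Finset (Finset V)} {A : Finset V}

theorem mem_commonLink {c : ℕ} {p : Finset V} : p ∈ commonLink H A c ↔
    p.card = c ∧ Disjoint p A ∧ ∀ s ∈ A, insert s p ∈ H := by
  rw [commonLink, Finset.mem_filter, Finset.mem_powersetCard, Finset.subset_sdiff]
  simp only [Finset.subset_univ, true_and]
  tauto

theorem notMem_of_mem_linkCore {c d : ℕ} {x : V} (hx : x ∈ linkCore H A c d) : x ∉ A := by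
  rw [linkCore, Finset.mem_filter, Finset.mem_sdiff] at hx
  exact hx.1.2

/-- The members of the common link containing a core vertex cannot all be hit by a small set. -/
theorem exists_mem_commonLink_disjoint {j K : ℕ} {x : V} {U : Finset V}
    (hx : x ∈ linkCore H A (j + 2) (K * Fintype.card V ^ j)) (hU : U.card ≤ K) (hxU : x ∉ U) :
    ∃ p ∈ commonLink H A (j + 2), x ∈ p ∧ Disjoint p U := by
  by_contra! hcon
  have h := card_le_of_exists_subset (P := U.image fun u => {x, u})
    (E := (commonLink H A (j + 2)).filter (x ∈ ·)) (W := Finset.univ) (c := j + 2) (s := 2)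
    (fun e he => (mem_commonLink.1 (Finset.mem_filter.1 he).1).1) (fun e _ => e.subset_univ)
    (by
      intro q hq
      obtain ⟨u, hu, rfl⟩ := Finset.mem_image.1 hq
      exact Finset.card_pair (by rintro rfl; exact hxU hu))
    (by
      intro e he
      rw [Finset.mem_filter] at he
      obtain ⟨u, hue, huU⟩ := Finset.not_disjoint_iff.1 (hcon e he.1 he.2)
      refine ⟨{x, u}, Finset.mem_image_of_mem _ huU, ?_⟩
      intro z hz
      simp only [Finset.mem_insert, Finset.mem_singleton] at hz
      rcases hz with rfl | rfl
      exacts [he.2, hue])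
  rw [linkCore, Finset.mem_filter] at hx
  have h2 : (U.image fun u => ({x, u} : Finset V)).card * Finset.univ.card ^ (j + 2 - 2) ≤
      K * Fintype.card V ^ j := Nat.mul_le_mul_right _ (Finset.card_image_le.trans hU)
  exact absurd hx.2 (by omega)

theorem card_commonLink_not_subset_le (c d : ℕ) :
    ((commonLink H A c).filter fun p => ¬ p ⊆ linkCore H A c d).card ≤ Fintype.card V * d := by
  have hsub : ((commonLink H A c).filter fun p => ¬ p ⊆ linkCore H A c d) ⊆
      (Finset.univ \ (A ∪ linkCore H A c d)).biUnion
        fun x => (commonLink H A c).filter (x ∈ ·) := by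
    intro p hp
    rw [Finset.mem_filter, Finset.not_subset] at hp
    obtain ⟨hp, x, hxp, hx⟩ := hp
    have hxA : x ∉ A := Finset.disjoint_left.1 (mem_commonLink.1 hp).2.1 hxp
    simp only [Finset.mem_biUnion, Finset.mem_sdiff, Finset.mem_union, Finset.mem_filter,
      Finset.mem_univ, true_and]
    exact ⟨x, by tauto, hp, hxp⟩
  refine (Finset.card_le_card hsub).trans <|
    (Finset.card_biUnion_le_card_mul _ _ d fun x hx => ?_).trans
      (Nat.mul_le_mul_right _ (Finset.card_le_univ _))
  simp only [Finset.mem_sdiff, Finset.mem_union, Finset.mem_univ, true_and, not_or] at hx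
  have h := hx.2
  rw [linkCore, Finset.mem_filter] at h
  simp only [Finset.mem_sdiff, Finset.mem_univ, true_and, hx.1, not_false_eq_true] at h
  omega

/-- An edge that avoids `A` and meets the core of `A` can be prolonged to a long linear path. -/
theorem exists_linearChain_of_linkCore {j K : ℕ} {e : Finset V} {x : V}
    (hk : ∀ e ∈ H, e.card = j + 3) (hK : (2 * A.card + 2) * (j + 3) + A.card ≤ K)
    (hrich : K < (linkCore H A (j + 2) (K * Fintype.card V ^ j)).card)
    (he : e ∈ H) (heA : Disjoint e A) (hxe : x ∈ e)
    (hx : x ∈ linkCore H A (j + 2) (K * Fintype.card V ^ j)) :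
    ∃ U y, LinearChain H (2 * A.card + 1) U y := by
  have key : ∀ S ⊆ A, ∃ U, ∃ y ∈ linkCore H A (j + 2) (K * Fintype.card V ^ j),
      LinearChain H (2 * S.card + 1) U y ∧ U ∩ A ⊆ S := by
    intro S
    induction S using Finset.induction_on with
    | empty =>
      intro _
      obtain ⟨z, hz, hzx⟩ := Finset.exists_mem_ne (by rw [hk e he]; omega : 1 < e.card) x
      refine ⟨{z} ∪ e, x, hx, (LinearChain.start z).step he ?_ hxe hzx.symm, ?_⟩
      · rw [Finset.inter_comm]
        exact Finset.singleton_inter_of_mem hz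
      · intro w hw
        rw [Finset.mem_inter, Finset.mem_union, Finset.mem_singleton] at hw
        rcases hw with ⟨rfl | hw, hwA⟩
        · exact absurd hwA (Finset.disjoint_left.1 heA hz)
        · exact absurd hwA (Finset.disjoint_left.1 heA hw)
    | insert s S hs ih =>
      intro hSA
      rw [Finset.insert_subset_iff] at hSA
      obtain ⟨U, y, hy, hc, hUS⟩ := ih hSA.2
      have hSlt : S.card + 1 ≤ A.card := by
        rw [← Finset.card_insert_of_notMem hs]
        exact Finset.card_le_card (Finset.insert_subset hSA.1 hSA.2)
      have hbound : (2 * S.card + 1 + 1) * (j + 3) ≤ (2 * A.card + 2) * (j + 3) :=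
        Nat.mul_le_mul_right _ (by omega)
      have hUc := hc.card_le hk
      have hsU : s ∉ U := fun h => hs (hUS (Finset.mem_inter.2 ⟨h, hSA.1⟩))
      obtain ⟨p, hp, hyp, hpU⟩ := exists_mem_commonLink_disjoint (U := U.erase y) hy
        ((Finset.card_le_card (Finset.erase_subset _ _)).trans (by
          rw [add_mul (2 * S.card + 1)] at hbound; omega)) (by simp)
      rw [mem_commonLink] at hp
      have hsy : s ≠ y := fun h => hsU (h ▸ hc.mem)
      have hc1 : LinearChain H (2 * S.card + 1 + 1) (U ∪ insert s p) s := by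
        refine hc.extend (hp.2.2 s hSA.1) (Finset.mem_insert_of_mem hyp) ?_
          (Finset.mem_insert_self _ _) hsy
        rw [Finset.disjoint_insert_left]
        exact ⟨fun h => hsU (Finset.mem_of_mem_erase h), hpU⟩
      have hU1 := hc1.card_le hk
      obtain ⟨z, hz, hzU⟩ := Finset.exists_mem_notMem_of_card_lt_card
        (lt_of_le_of_lt (hU1.trans (by omega)) hrich)
      obtain ⟨q, hq, hzq, hqU⟩ := exists_mem_commonLink_disjoint (U := U ∪ insert s p) hz
        (by omega) hzU
      rw [mem_commonLink] at hq
      have hzs : z ≠ s := fun h => notMem_of_mem_linkCore hz (h ▸ hSA.1)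
      refine ⟨U ∪ insert s p ∪ insert s q, z, hz, ?_, ?_⟩
      · rw [Finset.card_insert_of_notMem hs]
        refine hc1.extend (hq.2.2 s hSA.1) (Finset.mem_insert_self _ _) ?_
          (Finset.mem_insert_of_mem hzq) hzs
        rw [Finset.disjoint_insert_left]
        exact ⟨by simp, hqU.mono_right (Finset.erase_subset _ _)⟩
      · intro w hw
        simp only [Finset.mem_inter, Finset.mem_union, Finset.mem_insert] at hw
        rw [Finset.mem_insert]
        rcases hw with ⟨(hw | rfl | hw) | rfl | hw, hwA⟩
        · exact Or.inr (hUS (Finset.mem_inter.2 ⟨hw, hwA⟩))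
        · exact Or.inl rfl
        · exact absurd hwA (Finset.disjoint_left.1 hp.2.1 hw)
        · exact Or.inl rfl
        · exact absurd hwA (Finset.disjoint_left.1 hq.2.1 hw)
  obtain ⟨U, y, -, hc, -⟩ := key A subset_rfl
  exact ⟨U, y, hc⟩

end LinkCore

/-- If every vertex of `e` other than the last one has an out-neighbour in `e`, and the arcs inside
`e` contain no two arcs with a common head, no directed path with two arcs and no two disjoint
arcs, then `e` consists of two mutually joined vertices and a last one not joined to them. -/
theorem eq_triple_of_arcs {V : Type*} [DecidableEq V] {r : V → ℕ} {F : V → Finset V} {j : ℕ}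
    {e : Finset V} (hr : Function.Injective r) (he : e.card = j + 3)
    (harc : ∀ v ∈ e, ∀ u ∈ e, r v < r u → ∃ w ∈ e, w ∈ F v ∧ w ≠ v)
    (hS : ¬ ∃ a ∈ e, ∃ b ∈ e, ∃ w ∈ e, a ≠ b ∧ w ∈ F a ∧ w ∈ F b)
    (hQ : ¬ ∃ a ∈ e, ∃ b ∈ e, ∃ c ∈ e, a ≠ c ∧ b ∈ F a ∧ c ∈ F b)
    (hR : ¬ ∃ a ∈ e, ∃ b ∈ e, ∃ c ∈ e, ∃ d ∈ e, a ≠ c ∧ a ≠ d ∧ b ≠ c ∧ b ≠ d ∧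
      b ∈ F a ∧ d ∈ F c) :
    j = 0 ∧ ∃ w a b, e = {w, a, b} ∧ r a < r w ∧ r b < r w ∧ b ∈ F a ∧ a ∈ F b ∧
      w ∉ F a ∧ w ∉ F b := by
  obtain ⟨w, hw, hmax⟩ := e.exists_max_image r (Finset.card_pos.1 (by omega))
  have hlt : ∀ v ∈ e, v ≠ w → r v < r w := fun v hv hvw =>
    lt_of_le_of_ne (hmax v hv) fun h => hvw (hr h)
  have hheads : ∀ a ∈ e, ∀ b ∈ e, a ≠ b → ∀ a' ∈ e, a' ∈ F a → ∀ b' ∈ e, b' ∈ F b →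
      a' = b ∧ b' = a := by
    intro a ha b hb hab a' ha' haF b' hb' hbF
    have h1 : a' ≠ b' := by
      rintro rfl
      exact hS ⟨a, ha, b, hb, a', ha', hab, haF, hbF⟩
    by_cases h2 : a' = b
    · subst h2
      refine ⟨rfl, ?_⟩
      by_contra h3
      exact hQ ⟨a, ha, a', ha', b', hb', fun h => h3 h.symm, haF, hbF⟩
    · by_cases h3 : b' = a
      · subst h3
        exact absurd ⟨b, hb, b', hb', a', ha', fun h => h2 h.symm, hbF, haF⟩ hQ
      · exact absurd ⟨a, ha, a', ha', b, hb, b', hb', hab, fun h => h3 h.symm, h2, h1, haF, hbF⟩ hR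
  have hcard : (e.erase w).card = j + 2 := by rw [Finset.card_erase_of_mem hw, he]; rfl
  obtain ⟨a, ha, b, hb, hab⟩ := Finset.one_lt_card.1 (by omega : 1 < (e.erase w).card)
  have hj : j = 0 := by
    by_contra hj
    obtain ⟨a, ha, b, hb, c, hc, hab, hac, hbc⟩ :=
      Finset.two_lt_card.1 (by omega : 2 < (e.erase w).card)
    rw [Finset.mem_erase] at ha hb hc
    obtain ⟨a', ha', haF, -⟩ := harc a ha.2 w hw (hlt a ha.2 ha.1)
    obtain ⟨b', hb', hbF, -⟩ := harc b hb.2 w hw (hlt b hb.2 hb.1)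
    obtain ⟨c', hc', hcF, -⟩ := harc c hc.2 w hw (hlt c hc.2 hc.1)
    have h1 := (hheads a ha.2 b hb.2 hab a' ha' haF b' hb' hbF).1
    have h2 := (hheads a ha.2 c hc.2 hac a' ha' haF c' hc' hcF).1
    exact hbc (h1.symm.trans h2)
  rw [Finset.mem_erase] at ha hb
  obtain ⟨a', ha', haF, -⟩ := harc a ha.2 w hw (hlt a ha.2 ha.1)
  obtain ⟨b', hb', hbF, -⟩ := harc b hb.2 w hw (hlt b hb.2 hb.1)
  have h1 := hheads a ha.2 b hb.2 hab a' ha' haF b' hb' hbF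
  refine ⟨hj, w, a, b, ?_, hlt a ha.2 ha.1, hlt b hb.2 hb.1, h1.1 ▸ haF, h1.2 ▸ hbF, ?_, ?_⟩
  · refine (Finset.eq_of_subset_of_card_le ?_ ?_).symm
    · intro z hz
      simp only [Finset.mem_insert, Finset.mem_singleton] at hz
      rcases hz with rfl | rfl | rfl
      exacts [hw, ha.2, hb.2]
    · rw [he, hj, Finset.card_eq_three.2 ⟨w, a, b, ha.1.symm, hb.1.symm, hab, rfl⟩]
  · exact fun h => hb.1 (hheads a ha.2 b hb.2 hab w hw h b' hb' hbF).1.symm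
  · exact fun h => ha.1 (hheads a ha.2 b hb.2 hab a' ha' haF w hw h).2.symm

namespace IsElimination

variable {V : Type*} [DecidableEq V] [Fintype V] {H : Finset (Finset V)} {N : ℕ} {r : V → ℕ}
  {F : V → Finset V}

/-- Triples consisting of a vertex and an earlier pair of mutually joined vertices. -/
theorem card_triples_le (hE : IsElimination H N r F) {E : Finset (Finset V)} {Y : Finset V}
    (hEH : E ⊆ H) (hY : ∀ e ∈ E, e ⊆ Y)
    (hM : ∀ e ∈ E, ∃ w a b, e = {w, a, b} ∧ r a < r w ∧ r b < r w ∧ b ∈ F a ∧ a ∈ F b ∧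
      w ∉ F a ∧ w ∉ F b) :
    4 * E.card ≤ Y.card ^ 2 + 2 * N * (N + 1) ^ 2 * Fintype.card V := by
  classical
  set M : V → V → V → Prop := fun w a b => ({w, a, b} : Finset V) ∈ E ∧ r a < r w ∧ r b < r w ∧
    b ∈ F a ∧ a ∈ F b ∧ w ∉ F a ∧ w ∉ F b with hMdef
  have hMsymm : ∀ w a b, M w a b → M w b a := by
    rintro w a b ⟨h1, h2, h3, h4, h5, h6, h7⟩
    exact ⟨by rwa [Finset.pair_comm b a], h3, h2, h5, h4, h7, h6⟩
  have hMne : ∀ w a b, M w a b → a ≠ b := by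
    rintro w a b ⟨h1, h2, h3, h4, h5, h6, h7⟩ rfl
    exact hE.notMem _ h4
  set nb : V × V → Finset V := fun q => (F q.2).filter fun b => M q.1 q.2 b with hnb
  have hnbcard : ∀ q, (nb q).card ≤ N := fun q =>
    (Finset.card_filter_le _ _).trans (hE.card_le _)
  set D : Finset (V × V) := (Y ×ˢ Y).filter fun q => r q.2 < r q.1 with hD
  set C : Finset (V × V) := Finset.univ.filter fun q => 2 ≤ (nb q).card with hC
  -- the ordered triples, sorted by the order of the mutually joined pair
  set T₁ : Finset (V × V × V) := Finset.univ.filter fun q => M q.1 q.2.1 q.2.2 ∧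
    r q.2.1 < r q.2.2 with hT₁
  set T₂ : Finset (V × V × V) := Finset.univ.filter fun q => M q.1 q.2.1 q.2.2 ∧
    r q.2.2 < r q.2.1 with hT₂
  have hcov : ∀ e ∈ E, ∃ w a b, M w a b ∧ r a < r b ∧ e = {w, a, b} := by
    intro e he
    obtain ⟨w, a, b, rfl, h⟩ := hM e he
    have hm : M w a b := ⟨he, h⟩
    rcases lt_trichotomy (r a) (r b) with hlt | heq | hlt
    · exact ⟨w, a, b, hm, hlt, rfl⟩
    · exact absurd (hE.inj heq) (hMne _ _ _ hm)
    · exact ⟨w, b, a, hMsymm _ _ _ hm, hlt, by rw [Finset.pair_comm]⟩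
  have hT₁E : E.card ≤ T₁.card := by
    refine (Finset.card_le_card (t := T₁.image fun q => {q.1, q.2.1, q.2.2}) ?_).trans
      Finset.card_image_le
    intro e he
    obtain ⟨w, a, b, hm, hlt, rfl⟩ := hcov e he
    exact Finset.mem_image.2 ⟨(w, a, b), by simp [hT₁, hm, hlt], rfl⟩
  have hT₂E : E.card ≤ T₂.card := by
    refine (Finset.card_le_card (t := T₂.image fun q => {q.1, q.2.1, q.2.2}) ?_).trans
      Finset.card_image_le
    intro e he
    obtain ⟨w, a, b, hm, hlt, rfl⟩ := hcov e he
    exact Finset.mem_image.2 ⟨(w, b, a), by simp [hT₂, hMsymm _ _ _ hm, hlt],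
      by simp [Finset.pair_comm]⟩
  have hdisj : Disjoint T₁ T₂ := by
    rw [Finset.disjoint_left]
    intro q h1 h2
    simp only [hT₁, hT₂, Finset.mem_filter] at h1 h2
    omega
  have hTsub : T₁ ∪ T₂ ⊆ (D ∪ C).biUnion fun q => (nb q).image fun b => (q.1, q.2, b) := by
    rintro ⟨w, a, b⟩ hq
    have hm : M w a b := by
      simp only [hT₁, hT₂, Finset.mem_union, Finset.mem_filter] at hq
      tauto
    simp only [Finset.mem_biUnion, Finset.mem_image]
    refine ⟨(w, a), Finset.mem_union_left _ ?_, b, ?_, rfl⟩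
    · have := hY _ hm.1
      simp only [hD, Finset.mem_filter, Finset.mem_product]
      exact ⟨⟨this (by simp), this (by simp)⟩, hm.2.1⟩
    · exact Finset.mem_filter.2 ⟨hm.2.2.2.1, hm⟩
  have hTle : (T₁ ∪ T₂).card ≤ D.card + C.card * N := by
    calc (T₁ ∪ T₂).card ≤ ∑ q ∈ D ∪ C, (nb q).card :=
          (Finset.card_le_card hTsub).trans <| Finset.card_biUnion_le.trans <|
            Finset.sum_le_sum fun q _ => Finset.card_image_le
      _ ≤ ∑ q ∈ D ∪ C, ((if q ∈ D \ C then 1 else 0) + if q ∈ C then N else 0) := by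
          refine Finset.sum_le_sum fun q hq => ?_
          by_cases hqC : q ∈ C
          · simp [hqC, hnbcard q]
          · have hqD : q ∈ D := by
              rw [Finset.mem_union] at hq
              tauto
            simp only [Finset.mem_sdiff, hqD, hqC, not_false_eq_true, and_self, if_true, if_false]
            simp only [hC, Finset.mem_filter, Finset.mem_univ, true_and] at hqC
            omega
      _ ≤ D.card + C.card * N := by
          rw [Finset.sum_add_distrib, ← Finset.sum_filter, ← Finset.sum_filter,
            Finset.sum_const, Finset.sum_const, smul_eq_mul, smul_eq_mul, mul_one]
          refine Nat.add_le_add (Finset.card_le_card ?_)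
            (Nat.mul_le_mul_right _ (Finset.card_le_card ?_))
          · intro q hq
            exact (Finset.mem_sdiff.1 (Finset.mem_filter.1 hq).2).1
          · intro q hq
            exact (Finset.mem_filter.1 hq).2
  have hDle : 2 * D.card ≤ Y.card ^ 2 := by
    have hswap : (D.image Prod.swap).card = D.card :=
      Finset.card_image_of_injective _ Prod.swap_injective
    have hdis : Disjoint D (D.image Prod.swap) := by
      rw [Finset.disjoint_left]
      rintro ⟨a, b⟩ h1 h2
      obtain ⟨⟨c, d⟩, h3, h4⟩ := Finset.mem_image.1 h2
      simp only [Prod.swap_prod_mk, Prod.mk.injEq] at h4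
      obtain ⟨rfl, rfl⟩ := h4
      simp only [hD, Finset.mem_filter] at h1 h3
      omega
    have hsub : D ∪ D.image Prod.swap ⊆ Y ×ˢ Y := by
      rintro ⟨a, b⟩ h
      rw [Finset.mem_union, Finset.mem_image] at h
      rcases h with h | ⟨⟨c, d⟩, h, h4⟩
      · exact (Finset.mem_filter.1 h).1
      · simp only [Prod.swap_prod_mk, Prod.mk.injEq] at h4
        obtain ⟨rfl, rfl⟩ := h4
        have := Finset.mem_product.1 (Finset.mem_filter.1 h).1
        exact Finset.mem_product.2 ⟨this.2, this.1⟩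
    have := Finset.card_le_card hsub
    rw [Finset.card_union_of_disjoint hdis, hswap, Finset.card_product] at this
    linarith [sq Y.card]
  have hCle : C.card ≤ Fintype.card V * (N + 1) ^ 2 := by
    set α : Finset (V × V) := Finset.univ.biUnion fun w => (F w).biUnion fun f =>
      (insert f (F f)).image fun a => (w, a) with hα
    have hαle : α.card ≤ Fintype.card V * (N * (N + 1)) := by
      refine Finset.card_biUnion_le_card_mul _ _ _ fun w _ => ?_
      refine (Finset.card_biUnion_le_card_mul _ _ (N + 1) fun f _ => ?_).trans
        (Nat.mul_le_mul_right _ (hE.card_le w))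
      exact Finset.card_image_le.trans ((Finset.card_insert_le _ _).trans
        (Nat.add_le_add_right (hE.card_le f) 1))
    set β : V → Finset V := fun a => Finset.univ.filter fun w => (w, a) ∈ C ∧ (w, a) ∉ α with hβ
    have hβle : ∀ a, (β a).card ≤ N + 1 := by
      intro a
      rcases (β a).eq_empty_or_nonempty with h0 | hne
      · simp [h0]
      obtain ⟨w, hw, hmin⟩ := (β a).exists_min_image r hne
      have hsub : β a ⊆ insert w (F w) := by
        intro y hy
        by_cases hyw : y = w
        · simp [hyw]
        have hlt : r w < r y := lt_of_le_of_ne (hmin y hy) fun h => hyw (hE.inj h.symm)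
        simp only [hβ, hC, Finset.mem_filter, Finset.mem_univ, true_and] at hw hy
        have hα' : ∀ f ∈ F w, a ≠ f ∧ a ∉ F f := by
          intro f hf
          by_contra hcon
          apply hw.2
          simp only [hα, Finset.mem_biUnion, Finset.mem_image, Finset.mem_univ, true_and,
            Finset.mem_insert]
          exact ⟨w, f, hf, a, by tauto, rfl⟩
        obtain ⟨b, hb⟩ := Finset.card_pos.1 (by omega : 0 < (nb (w, a)).card)
        obtain ⟨c, hc, hcb⟩ := Finset.exists_mem_ne (by omega : 1 < (nb (y, a)).card) b
        obtain ⟨-, hbE, hb1, hb2, hb3, hb4, hb5, hb6⟩ := Finset.mem_filter.1 hb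
        obtain ⟨-, hcE, hc1, hc2, hc3, hc4, hc5, hc6⟩ := Finset.mem_filter.1 hc
        dsimp only at hbE hb1 hb2 hb3 hb4 hb5 hb6 hcE hc1 hc2 hc3 hc4 hc5 hc6
        by_contra hyF
        rw [Finset.mem_insert, not_or] at hyF
        have haw : a ∉ F w := fun h => (hα' a h).1 rfl
        have hbw : b ∉ F w := fun h => (hα' b h).2 hb4
        have hcw : c ∉ F w := fun h => (hα' c h).2 hc4
        refine hE.two_step w {w, a, b} (hEH hbE) {y, a, c} (hEH hcE) a (by simp) ?_ ?_ ?_ ?_ y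
          (by simp) ?_ hlt.le
        · ext z
          simp only [Finset.mem_inter, Finset.mem_insert, Finset.mem_singleton]
          constructor
          · rintro ⟨h1 | h1 | h1, h2 | h2 | h2⟩
            all_goals first
              | exact h1
              | exact h2
              | exfalso
                have h := h1.symm.trans h2
                first
                  | exact hyw h.symm
                  | exact hcb h.symm
                  | exact hb5 (h ▸ hc3)
                  | rw [h] at hb2; omega
          · rintro rfl
            simp
        · rintro rfl
          omega
        · simp [hE.notMem w, haw, hbw]
        · simp [hyF.2, haw, hcw]
        · rintro rfl
          omega
      exact (Finset.card_le_card hsub).trans ((Finset.card_insert_le _ _).trans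
        (Nat.add_le_add_right (hE.card_le w) 1))
    have hsub : C ⊆ α ∪ Finset.univ.biUnion fun a => (β a).image fun w => (w, a) := by
      rintro ⟨w, a⟩ hq
      rw [Finset.mem_union]
      by_cases h : (w, a) ∈ α
      · exact Or.inl h
      · right
        simp only [Finset.mem_biUnion, Finset.mem_image, Finset.mem_univ, true_and]
        exact ⟨a, w, by simp [hβ, hq, h], rfl⟩
    have h1 : (Finset.univ.biUnion fun a => (β a).image fun w => (w, a)).card ≤
        Fintype.card V * (N + 1) :=
      Finset.card_biUnion_le_card_mul _ _ _ fun a _ => Finset.card_image_le.trans (hβle a)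
    have h2 := (Finset.card_le_card hsub).trans (Finset.card_union_le _ _)
    nlinarith
  rw [Finset.card_union_of_disjoint hdisj] at hTle
  have h3 : C.card * N ≤ Fintype.card V * (N + 1) ^ 2 * N := Nat.mul_le_mul_right _ hCle
  linarith

end IsElimination

namespace IsElimination

variable {V : Type*} [DecidableEq V] [Fintype V] {H : Finset (Finset V)} {N : ℕ} {r : V → ℕ}
  {F : V → Finset V}

/-- Only boundedly many vertices are obstacles for a positive proportion of the vertices. -/
theorem card_popular_le (hE : IsElimination H N r F) (T : ℕ) :
    (Finset.univ.filter fun w =>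
      Fintype.card V < T * (Finset.univ.filter (w ∈ F ·)).card).card ≤ T * N := by
  rcases Nat.eq_zero_or_pos (Fintype.card V) with h0 | hpos
  · exact (Finset.card_le_univ _).trans (by omega)
  set L := Finset.univ.filter fun w =>
    Fintype.card V < T * (Finset.univ.filter (w ∈ F ·)).card with hL
  have h1 : ∑ w, (Finset.univ.filter (w ∈ F ·)).card ≤ Fintype.card V * N := by
    have := Finset.sum_card_bipartiteAbove_eq_sum_card_bipartiteBelow
      (s := (Finset.univ : Finset V)) (t := (Finset.univ : Finset V)) (fun w v => w ∈ F v)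
    simp only [Finset.bipartiteAbove, Finset.bipartiteBelow] at this
    rw [this]
    calc _ ≤ ∑ _v : V, N := Finset.sum_le_sum fun v _ => by
          simpa using hE.card_le v
      _ = _ := by simp
  have h2 : L.card * Fintype.card V ≤ (T * N) * Fintype.card V := by
    calc L.card * Fintype.card V = ∑ w ∈ L, Fintype.card V := by simp
      _ ≤ ∑ w ∈ L, T * (Finset.univ.filter (w ∈ F ·)).card :=
          Finset.sum_le_sum fun w hw => (Finset.mem_filter.1 hw).2.le
      _ ≤ ∑ w, T * (Finset.univ.filter (w ∈ F ·)).card :=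
          Finset.sum_le_sum_of_subset (Finset.subset_univ _)
      _ = T * ∑ w, (Finset.univ.filter (w ∈ F ·)).card := by rw [Finset.mul_sum]
      _ ≤ T * (Fintype.card V * N) := Nat.mul_le_mul_left _ h1
      _ = _ := by ring
  exact Nat.le_of_mul_le_mul_right h2 hpos

theorem card_common_head_le (hE : IsElimination H N r F) {j T : ℕ} {B : Finset (Finset V)}
    (hk : ∀ e ∈ B, e.card = j + 3)
    (hpop : ∀ e ∈ B, ∀ w ∈ e, T * (Finset.univ.filter (w ∈ F ·)).card ≤ Fintype.card V)
    (hS : ∀ e ∈ B, ∃ a ∈ e, ∃ b ∈ e, ∃ w ∈ e, a ≠ b ∧ w ∈ F a ∧ w ∈ F b) :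
    T * B.card ≤ N * Fintype.card V ^ (j + 2) := by
  set P : Finset (Finset V) := (Finset.univ.biUnion fun a =>
    ((F a).filter fun w => T * (Finset.univ.filter (w ∈ F ·)).card ≤ Fintype.card V).biUnion
      fun w => (Finset.univ.filter (w ∈ F ·)).image fun b => {a, w, b}).filter
        fun q => q.card = 3 with hP
  have hPle : T * P.card ≤ Fintype.card V * (N * Fintype.card V) := by
    have h1 : P.card ≤ ∑ a, ∑ w ∈ (F a).filter
        (fun w => T * (Finset.univ.filter (w ∈ F ·)).card ≤ Fintype.card V),
        (Finset.univ.filter (w ∈ F ·)).card :=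
      (Finset.card_filter_le _ _).trans <| Finset.card_biUnion_le.trans <|
        Finset.sum_le_sum fun a _ => Finset.card_biUnion_le.trans <|
          Finset.sum_le_sum fun w _ => Finset.card_image_le
    refine (Nat.mul_le_mul_left T h1).trans ?_
    rw [Finset.mul_sum]
    calc _ ≤ ∑ _a : V, N * Fintype.card V := by
          refine Finset.sum_le_sum fun a _ => ?_
          rw [Finset.mul_sum]
          refine (Finset.sum_le_card_nsmul _ _ (Fintype.card V)
            fun w hw => (Finset.mem_filter.1 hw).2).trans ?_
          exact Nat.mul_le_mul_right _ ((Finset.card_filter_le _ _).trans (hE.card_le a))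
      _ = _ := by simp
  have h := card_le_of_exists_subset (P := P) (E := B) (W := Finset.univ) (c := j + 3) (s := 3)
    hk (fun e _ => e.subset_univ) (fun q hq => (Finset.mem_filter.1 hq).2) (by
      intro e he
      obtain ⟨a, ha, b, hb, w, hw, hab, hwa, hwb⟩ := hS e he
      refine ⟨{a, w, b}, Finset.mem_filter.2 ⟨?_, ?_⟩, ?_⟩
      · simp only [Finset.mem_biUnion, Finset.mem_image, Finset.mem_univ, true_and,
          Finset.mem_filter]
        exact ⟨a, w, ⟨hwa, hpop e he w hw⟩, b, hwb, rfl⟩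
      · refine Finset.card_eq_three.2 ⟨a, w, b, ?_, hab, ?_, rfl⟩
        · rintro rfl
          exact hE.notMem _ hwa
        · rintro rfl
          exact hE.notMem _ hwb
      · intro z hz
        simp only [Finset.mem_insert, Finset.mem_singleton] at hz
        rcases hz with rfl | rfl | rfl <;> assumption)
  rw [Nat.add_sub_cancel, Finset.card_univ] at h
  calc T * B.card ≤ T * (P.card * Fintype.card V ^ j) := Nat.mul_le_mul_left _ h
    _ = T * P.card * Fintype.card V ^ j := by ring
    _ ≤ Fintype.card V * (N * Fintype.card V) * Fintype.card V ^ j := Nat.mul_le_mul_right _ hPle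
    _ = _ := by ring

theorem card_directed_path_le (hE : IsElimination H N r F) {j : ℕ} {B : Finset (Finset V)}
    (hk : ∀ e ∈ B, e.card = j + 3)
    (hQ : ∀ e ∈ B, ∃ a ∈ e, ∃ b ∈ e, ∃ c ∈ e, a ≠ c ∧ b ∈ F a ∧ c ∈ F b) :
    B.card ≤ N ^ 2 * Fintype.card V ^ (j + 1) := by
  set P : Finset (Finset V) := (Finset.univ.biUnion fun a => (F a).biUnion
    fun b => (F b).image fun c => {a, b, c}).filter fun q => q.card = 3 with hP
  have hPle : P.card ≤ Fintype.card V * (N * N) := by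
    refine (Finset.card_filter_le _ _).trans <| Finset.card_biUnion_le_card_mul _ _ _ fun a _ =>
      (Finset.card_biUnion_le_card_mul _ _ N fun b _ => ?_).trans
        (Nat.mul_le_mul_right _ (hE.card_le a))
    exact Finset.card_image_le.trans (hE.card_le b)
  have h := card_le_of_exists_subset (P := P) (E := B) (W := Finset.univ) (c := j + 3) (s := 3)
    hk (fun e _ => e.subset_univ) (fun q hq => (Finset.mem_filter.1 hq).2) (by
      intro e he
      obtain ⟨a, ha, b, hb, c, hc, hac, hba, hcb⟩ := hQ e he
      refine ⟨{a, b, c}, Finset.mem_filter.2 ⟨?_, ?_⟩, ?_⟩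
      · simp only [Finset.mem_biUnion, Finset.mem_image, Finset.mem_univ, true_and]
        exact ⟨a, b, hba, c, hcb, rfl⟩
      · refine Finset.card_eq_three.2 ⟨a, b, c, ?_, hac, ?_, rfl⟩
        · rintro rfl
          exact hE.notMem _ hba
        · rintro rfl
          exact hE.notMem _ hcb
      · intro z hz
        simp only [Finset.mem_insert, Finset.mem_singleton] at hz
        rcases hz with rfl | rfl | rfl <;> assumption)
  rw [Nat.add_sub_cancel, Finset.card_univ] at h
  calc B.card ≤ P.card * Fintype.card V ^ j := h
    _ ≤ Fintype.card V * (N * N) * Fintype.card V ^ j := Nat.mul_le_mul_right _ hPle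
    _ = _ := by ring

theorem card_disjoint_arcs_le (hE : IsElimination H N r F) {j : ℕ} {B : Finset (Finset V)}
    (hk : ∀ e ∈ B, e.card = j + 3)
    (hR : ∀ e ∈ B, ∃ a ∈ e, ∃ b ∈ e, ∃ c ∈ e, ∃ d ∈ e, a ≠ c ∧ a ≠ d ∧ b ≠ c ∧ b ≠ d ∧
      b ∈ F a ∧ d ∈ F c) :
    B.card ≤ N ^ 2 * Fintype.card V ^ (j + 1) := by
  set P : Finset (Finset V) := (Finset.univ.biUnion fun a => (F a).biUnion
    fun b => Finset.univ.biUnion fun c => (F c).image fun d => {a, b, c, d}).filter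
      fun q => q.card = 4 with hP
  have hPle : P.card ≤ Fintype.card V * (N * (Fintype.card V * N)) := by
    refine (Finset.card_filter_le _ _).trans <| Finset.card_biUnion_le_card_mul _ _ _ fun a _ =>
      (Finset.card_biUnion_le_card_mul _ _ (Fintype.card V * N) fun b _ => ?_).trans
        (Nat.mul_le_mul_right _ (hE.card_le a))
    exact Finset.card_biUnion_le_card_mul _ _ _ fun c _ =>
      Finset.card_image_le.trans (hE.card_le c)
  have hfour : ∀ e ∈ B, ∃ q ∈ P, q ⊆ e := by
    intro e he
    obtain ⟨a, ha, b, hb, c, hc, d, hd, hac, had, hbc, hbd, hba, hdc⟩ := hR e he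
    refine ⟨{a, b, c, d}, Finset.mem_filter.2 ⟨?_, ?_⟩, ?_⟩
    · simp only [Finset.mem_biUnion, Finset.mem_image, Finset.mem_univ, true_and]
      exact ⟨a, b, hba, c, d, hdc, rfl⟩
    · have hab : a ≠ b := by
        rintro rfl
        exact hE.notMem _ hba
      have hcd : c ≠ d := by
        rintro rfl
        exact hE.notMem _ hdc
      rw [Finset.card_insert_of_notMem (by simp [hab, hac, had]),
        Finset.card_eq_three.2 ⟨b, c, d, hbc, hbd, hcd, rfl⟩]
    · intro z hz
      simp only [Finset.mem_insert, Finset.mem_singleton] at hz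
      rcases hz with rfl | rfl | rfl | rfl <;> assumption
  have hP4 : ∀ q ∈ P, q.card = 4 := fun q hq => (Finset.mem_filter.1 hq).2
  rcases j with _ | i
  · rcases B.eq_empty_or_nonempty with rfl | ⟨e, he⟩
    · simp
    obtain ⟨q, hq, hqe⟩ := hfour e he
    have h1 := Finset.card_le_card hqe
    rw [hP4 q hq, hk e he] at h1
    omega
  have h := card_le_of_exists_subset (P := P) (E := B) (W := Finset.univ) (c := i + 1 + 3) (s := 4)
    hk (fun e _ => e.subset_univ) hP4 hfour
  rw [show i + 1 + 3 - 4 = i by omega, Finset.card_univ] at h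
  calc B.card ≤ P.card * Fintype.card V ^ i := h
    _ ≤ Fintype.card V * (N * (Fintype.card V * N)) * Fintype.card V ^ i :=
        Nat.mul_le_mul_right _ hPle
    _ = _ := by ring

/-- The number of edges avoiding all popular vertices. -/
theorem card_unpopular_le (hE : IsElimination H N r F) {j T : ℕ} {B : Finset (Finset V)}
    {Y : Finset V} (hB : B ⊆ H) (hk : ∀ e ∈ H, e.card = j + 3) (hY : ∀ e ∈ B, e ⊆ Y)
    (hpop : ∀ e ∈ B, ∀ w ∈ e, T * (Finset.univ.filter (w ∈ F ·)).card ≤ Fintype.card V) :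
    2 * (j + 2).factorial * (T * B.card) ≤ T * Y.card ^ (j + 2) +
      2 * (j + 2).factorial * N * Fintype.card V ^ (j + 2) +
      T * (4 * (j + 2).factorial * (N + 1) ^ 3) * Fintype.card V ^ (j + 1) := by
  classical
  set pS : Finset V → Prop := fun e => ∃ a ∈ e, ∃ b ∈ e, ∃ w ∈ e, a ≠ b ∧ w ∈ F a ∧ w ∈ F b
  set pQ : Finset V → Prop := fun e => ∃ a ∈ e, ∃ b ∈ e, ∃ c ∈ e, a ≠ c ∧ b ∈ F a ∧ c ∈ F b
  set pR : Finset V → Prop := fun e => ∃ a ∈ e, ∃ b ∈ e, ∃ c ∈ e, ∃ d ∈ e,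
    a ≠ c ∧ a ≠ d ∧ b ≠ c ∧ b ≠ d ∧ b ∈ F a ∧ d ∈ F c
  set B₀ := B.filter fun e => ¬ pS e ∧ ¬ pQ e ∧ ¬ pR e with hB₀
  have hS := hE.card_common_head_le (j := j) (T := T) (B := B.filter pS)
    (fun e he => hk e (hB (Finset.mem_filter.1 he).1))
    (fun e he => hpop e (Finset.mem_filter.1 he).1) (fun e he => (Finset.mem_filter.1 he).2)
  have hQ := hE.card_directed_path_le (j := j) (B := B.filter pQ)
    (fun e he => hk e (hB (Finset.mem_filter.1 he).1)) (fun e he => (Finset.mem_filter.1 he).2)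
  have hR := hE.card_disjoint_arcs_le (j := j) (B := B.filter pR)
    (fun e he => hk e (hB (Finset.mem_filter.1 he).1)) (fun e he => (Finset.mem_filter.1 he).2)
  have hcard : B.card ≤ (B.filter pS).card + (B.filter pQ).card + (B.filter pR).card +
      B₀.card := by
    have hsub : B ⊆ B.filter pS ∪ B.filter pQ ∪ B.filter pR ∪ B₀ := by
      intro e he
      simp only [hB₀, Finset.mem_union, Finset.mem_filter, he, true_and]
      by_cases h1 : pS e <;> by_cases h2 : pQ e <;> by_cases h3 : pR e <;> simp [h1, h2, h3]
    refine (Finset.card_le_card hsub).trans ((Finset.card_union_le _ _).trans ?_)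
    refine Nat.add_le_add_right ((Finset.card_union_le _ _).trans ?_) _
    exact Nat.add_le_add_right (Finset.card_union_le _ _) _
  have htriple : ∀ e ∈ B₀, j = 0 ∧ ∃ w a b, e = {w, a, b} ∧ r a < r w ∧ r b < r w ∧ b ∈ F a ∧
      a ∈ F b ∧ w ∉ F a ∧ w ∉ F b := by
    intro e he
    rw [hB₀, Finset.mem_filter] at he
    exact eq_triple_of_arcs hE.inj (hk e (hB he.1))
      (fun v hv u hu hvu => hE.exists_arc (hB he.1) hv hu hvu) he.2.1 he.2.2.1 he.2.2.2
  have h₀ : 2 * (j + 2).factorial * B₀.card ≤ Y.card ^ (j + 2) +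
      2 * N * (N + 1) ^ 2 * Fintype.card V ^ (j + 1) := by
    rcases B₀.eq_empty_or_nonempty with h0 | ⟨e, he⟩
    · simp [h0]
    obtain ⟨rfl, -⟩ := htriple e he
    have := hE.card_triples_le (E := B₀) (Y := Y) ((Finset.filter_subset _ _).trans hB)
      (fun e he => hY e (Finset.mem_filter.1 he).1) (fun e he => (htriple e he).2)
    simpa using this
  set n := Fintype.card V
  set f := (j + 2).factorial with hf
  have hf1 : 1 ≤ f := Nat.factorial_pos _
  have hN : 2 * (f * (2 * N ^ 2)) + 2 * N * (N + 1) ^ 2 ≤ 4 * f * (N + 1) ^ 3 := by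
    nlinarith [Nat.mul_le_mul_right (2 * N * (N + 1) ^ 2) hf1, Nat.zero_le (f * N), 
      Nat.zero_le (f * N ^ 2), Nat.zero_le (f * N ^ 3)]
  calc 2 * f * (T * B.card)
      ≤ 2 * f * (T * ((B.filter pS).card + (B.filter pQ).card + (B.filter pR).card + B₀.card)) := by
        gcongr
    _ = 2 * f * (T * (B.filter pS).card) + 2 * f * (T * (B.filter pQ).card) +
        2 * f * (T * (B.filter pR).card) + T * (2 * f * B₀.card) := by ring
    _ ≤ 2 * f * (N * n ^ (j + 2)) + 2 * f * (T * (N ^ 2 * n ^ (j + 1))) +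
        2 * f * (T * (N ^ 2 * n ^ (j + 1))) +
        T * (Y.card ^ (j + 2) + 2 * N * (N + 1) ^ 2 * n ^ (j + 1)) := by gcongr
    _ = T * Y.card ^ (j + 2) + 2 * f * N * n ^ (j + 2) +
        T * (2 * (f * (2 * N ^ 2)) + 2 * N * (N + 1) ^ 2) * n ^ (j + 1) := by ring
    _ ≤ _ := by gcongr

end IsElimination

section MainCount

variable {V : Type*} [DecidableEq V] [Fintype V] {H : Finset (Finset V)} {j t K : ℕ}

theorem disjoint_linkCore_of_disjoint {A e : Finset V} (hk : ∀ e ∈ H, e.card = j + 3)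
    (hfree : ∀ U x, ¬ LinearChain H (2 * t + 1) U x) (hK : (2 * t + 2) * (j + 3) + t ≤ K)
    (hA : A.card = t) (hrich : K < (linkCore H A (j + 2) (K * Fintype.card V ^ j)).card)
    (he : e ∈ H) (heA : Disjoint e A) :
    Disjoint e (linkCore H A (j + 2) (K * Fintype.card V ^ j)) := by
  rw [Finset.disjoint_left]
  intro x hxe hx
  subst hA
  obtain ⟨U, y, hc⟩ := exists_linearChain_of_linkCore hk hK hrich he heA hxe hx
  exact hfree U y hc

theorem disjoint_linkCore {A A' : Finset V} (hk : ∀ e ∈ H, e.card = j + 3)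
    (hfree : ∀ U x, ¬ LinearChain H (2 * t + 1) U x) (hK : (2 * t + 2) * (j + 3) + t ≤ K)
    (hA : A.card = t) (hA' : A'.card = t) (hne : A ≠ A')
    (hrich : K < (linkCore H A (j + 2) (K * Fintype.card V ^ j)).card) :
    Disjoint (linkCore H A (j + 2) (K * Fintype.card V ^ j))
      (linkCore H A' (j + 2) (K * Fintype.card V ^ j)) := by
  rw [Finset.disjoint_left]
  intro x hx hx'
  obtain ⟨v, hv, hvA⟩ : ∃ v ∈ A', v ∉ A := by
    by_contra! hcon
    exact hne (Finset.eq_of_subset_of_card_le hcon (by omega)).symm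
  obtain ⟨p, hp, hxp, hpA⟩ := exists_mem_commonLink_disjoint (U := A) hx'
    (by omega) (notMem_of_mem_linkCore hx)
  have hd := disjoint_linkCore_of_disjoint hk hfree hK hA hrich ((mem_commonLink.1 hp).2.2 v hv)
    (by rw [Finset.disjoint_insert_left]; exact ⟨hvA, hpA⟩)
  exact Finset.disjoint_left.1 hd (Finset.mem_insert_of_mem hxp) hx

/-- The edges meeting `L` are counted through the sets of size `j + 2` outside `L`. -/
theorem card_le_sum_neighbors (hk : ∀ e ∈ H, e.card = j + 3) (L : Finset V) :
    H.card ≤ (H.filter (Disjoint · L)).card + L.card ^ 2 * Fintype.card V ^ (j + 1) +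
      ∑ p ∈ Finset.powersetCard (j + 2) (Finset.univ \ L),
        (L.filter fun v => insert v p ∈ H).card := by
  set E₂ := H.filter fun e => 1 < (e ∩ L).card with hE₂
  have h₂ : E₂.card ≤ L.card ^ 2 * Fintype.card V ^ (j + 1) := by
    have h := card_le_of_exists_subset (P := Finset.powersetCard 2 L) (E := E₂)
      (W := Finset.univ) (c := j + 3) (s := 2) (fun e he => hk e (Finset.mem_filter.1 he).1)
      (fun e _ => e.subset_univ) (fun q hq => (Finset.mem_powersetCard.1 hq).2) (by
        intro e he
        obtain ⟨q, hq, hq2⟩ := Finset.exists_subset_card_eq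
          (Nat.succ_le_of_lt (Finset.mem_filter.1 he).2)
        exact ⟨q, Finset.mem_powersetCard.2 ⟨hq.trans Finset.inter_subset_right, hq2⟩,
          hq.trans Finset.inter_subset_left⟩)
    refine h.trans ?_
    rw [Finset.card_powersetCard, Finset.card_univ]
    exact Nat.mul_le_mul_right _ (Nat.choose_le_pow _ _)
  have hsub : H ⊆ H.filter (Disjoint · L) ∪ E₂ ∪
      (Finset.powersetCard (j + 2) (Finset.univ \ L)).biUnion fun p =>
        (L.filter fun v => insert v p ∈ H).image fun v => insert v p := by
    intro e he
    simp only [Finset.mem_union, Finset.mem_biUnion, Finset.mem_image, hE₂, Finset.mem_filter, he,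
      true_and, Finset.mem_powersetCard]
    rcases lt_trichotomy (e ∩ L).card 1 with h | h | h
    · left; left
      rw [Finset.disjoint_iff_inter_eq_empty, ← Finset.card_eq_zero]
      omega
    · right
      obtain ⟨v, hv⟩ := Finset.card_eq_one.1 h
      have hv' : v ∈ e ∩ L := hv ▸ Finset.mem_singleton_self v
      rw [Finset.mem_inter] at hv'
      have hins : insert v (e.erase v) = e := Finset.insert_erase hv'.1
      refine ⟨e.erase v, ⟨?_, ?_⟩, v, ⟨hv'.2, hins.symm ▸ he⟩, hins⟩
      · intro z hz
        rw [Finset.mem_erase] at hz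
        simp only [Finset.mem_sdiff, Finset.mem_univ, true_and]
        intro hzL
        apply hz.1
        rw [← Finset.mem_singleton, ← hv]
        exact Finset.mem_inter.2 ⟨hz.2, hzL⟩
      · rw [Finset.card_erase_of_mem hv'.1, hk e he]
        rfl
    · left; right
      exact h
  refine (Finset.card_le_card hsub).trans ((Finset.card_union_le _ _).trans ?_)
  refine Nat.add_le_add ((Finset.card_union_le _ _).trans (Nat.add_le_add_left h₂ _)) ?_
  exact Finset.card_biUnion_le.trans (Finset.sum_le_sum fun p _ => Finset.card_image_le)

/-- Up to lower order terms, a set of size `j + 2` outside `L` forms edges with at most `t - 1`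
vertices of `L`, or it lies inside the core of a `t`-subset of `L`. -/
theorem sum_neighbors_le (hk : ∀ e ∈ H, e.card = j + 3)
    (hfree : ∀ U x, ¬ LinearChain H (2 * t + 1) U x) (hK : (2 * t + 2) * (j + 3) + t ≤ K)
    (ht : 1 ≤ t) (hV : 1 ≤ Fintype.card V) {L : Finset V} {ℓ : ℕ} (hL : L.card ≤ ℓ) :
    ∑ p ∈ Finset.powersetCard (j + 2) (Finset.univ \ L), (L.filter fun v => insert v p ∈ H).card ≤
      (t - 1) * (Fintype.card V).choose (j + 2) +
      ∑ A ∈ (Finset.powersetCard t L).filter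
        (fun A => K < (linkCore H A (j + 2) (K * Fintype.card V ^ j)).card),
        (linkCore H A (j + 2) (K * Fintype.card V ^ j)).card.choose (j + 2) +
      ℓ * (2 ^ ℓ * (K + K ^ (j + 2)) * Fintype.card V ^ (j + 1)) := by
  set n := Fintype.card V with hn
  set core : Finset V → Finset V := fun A => linkCore H A (j + 2) (K * n ^ j) with hcore
  set 𝒜 := (Finset.powersetCard t L).filter fun A => K < (core A).card with h𝒜
  set exc : Finset (Finset V) := (Finset.powersetCard t L).biUnion fun A =>
    (commonLink H A (j + 2)).filter (fun p => ¬ p ⊆ core A) ∪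
      if K < (core A).card then ∅ else Finset.powersetCard (j + 2) (core A) with hexc
  have hexcle : exc.card ≤ 2 ^ ℓ * (K + K ^ (j + 2)) * n ^ (j + 1) := by
    have h1 : (Finset.powersetCard t L).card ≤ 2 ^ ℓ := by
      rw [Finset.card_powersetCard]
      exact (Nat.choose_le_two_pow _ _).trans (Nat.pow_le_pow_right (by norm_num) hL)
    rw [mul_assoc]
    refine (Finset.card_biUnion_le_card_mul _ _ ((K + K ^ (j + 2)) * n ^ (j + 1))
      fun A _ => ?_).trans (Nat.mul_le_mul_right _ h1)
    refine (Finset.card_union_le _ _).trans ?_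
    rw [add_mul]
    refine Nat.add_le_add ?_ ?_
    · refine (card_commonLink_not_subset_le (j + 2) (K * n ^ j)).trans (le_of_eq ?_)
      rw [← hn]
      ring
    · refine le_trans ?_ (Nat.le_mul_of_pos_right _ (pow_pos hV _))
      split_ifs with h
      · simp
      · rw [Finset.card_powersetCard]
        exact (Nat.choose_le_pow _ _).trans (Nat.pow_le_pow_left (by omega) _)
  have hpoint : ∀ p ∈ Finset.powersetCard (j + 2) (Finset.univ \ L),
      (L.filter fun v => insert v p ∈ H).card ≤ (t - 1) + ∑ A ∈ 𝒜, (if p ⊆ core A then 1 else 0) +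
        if p ∈ exc then ℓ else 0 := by
    intro p hp
    rw [Finset.mem_powersetCard, Finset.subset_sdiff] at hp
    set nb := L.filter fun v => insert v p ∈ H with hnb
    by_cases hlt : nb.card < t
    · omega
    obtain ⟨A, hAnb, hAt⟩ := Finset.exists_subset_card_eq (not_lt.1 hlt)
    have hAL : A ⊆ L := hAnb.trans (Finset.filter_subset _ _)
    have hpR : p ∈ commonLink H A (j + 2) := mem_commonLink.2
      ⟨hp.2, hp.1.2.mono_right hAL, fun s hs => (Finset.mem_filter.1 (hAnb hs)).2⟩
    have hAmem : A ∈ Finset.powersetCard t L := Finset.mem_powersetCard.2 ⟨hAL, hAt⟩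
    by_cases hpe : p ∈ exc
    · have : nb.card ≤ ℓ := (Finset.card_filter_le _ _).trans hL
      simp only [hpe, if_true]
      omega
    have hpe' : ∀ A ∈ Finset.powersetCard t L, p ∉ (commonLink H A (j + 2)).filter
        (fun p => ¬ p ⊆ core A) ∪
        if K < (core A).card then ∅ else Finset.powersetCard (j + 2) (core A) :=
      fun A hA h => hpe (Finset.mem_biUnion.2 ⟨A, hA, h⟩)
    have h1 := hpe' A hAmem
    rw [Finset.mem_union, not_or, Finset.mem_filter] at h1
    have hsub : p ⊆ core A := by
      by_contra hcon
      exact h1.1 ⟨hpR, hcon⟩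
    have hrich : K < (core A).card := by
      by_contra hcon
      have := h1.2
      rw [if_neg hcon] at this
      exact this (Finset.mem_powersetCard.2 ⟨hsub, hp.2⟩)
    have hnbA : nb ⊆ A := by
      intro v hv
      by_contra hvA
      rw [hnb, Finset.mem_filter] at hv
      have hd := disjoint_linkCore_of_disjoint hk hfree hK hAt hrich hv.2
        (by
          rw [Finset.disjoint_insert_left]
          exact ⟨hvA, hp.1.2.mono_right hAL⟩)
      obtain ⟨x, hx⟩ := Finset.card_pos.1 (by omega : 0 < p.card)
      exact Finset.disjoint_left.1 hd (Finset.mem_insert_of_mem hx) (hsub hx)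
    have hle := Finset.card_le_card hnbA
    have hone : 1 ≤ ∑ A ∈ 𝒜, (if p ⊆ core A then 1 else 0) := by
      refine le_trans (by simp [hsub]) (Finset.single_le_sum
        (f := fun A => if p ⊆ core A then 1 else 0) (fun _ _ => Nat.zero_le _)
        (Finset.mem_filter.2 ⟨hAmem, hrich⟩))
    omega
  refine (Finset.sum_le_sum hpoint).trans ?_
  rw [Finset.sum_add_distrib, Finset.sum_add_distrib, Finset.sum_comm]
  refine Nat.add_le_add (Nat.add_le_add ?_ ?_) ?_
  · rw [Finset.sum_const, smul_eq_mul, mul_comm, Finset.card_powersetCard]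
    exact Nat.mul_le_mul_left _ (Nat.choose_le_choose _ (Finset.card_le_univ _))
  · refine Finset.sum_le_sum fun A _ => ?_
    rw [← Finset.sum_filter, Finset.sum_const, smul_eq_mul, mul_one, ← Finset.card_powersetCard]
    refine Finset.card_le_card fun p hp => ?_
    rw [Finset.mem_filter, Finset.mem_powersetCard] at hp
    exact Finset.mem_powersetCard.2 ⟨hp.2, hp.1.2⟩
  · rw [← Finset.sum_filter, Finset.sum_const, smul_eq_mul, mul_comm]
    refine Nat.mul_le_mul_left _ ((Finset.card_le_card fun p hp => ?_).trans hexcle)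
    exact (Finset.mem_filter.1 hp).2

end MainCount

theorem pow_succ_le_sub_pow_add (n a d : ℕ) :
    n ^ (d + 1) ≤ (n - a) ^ (d + 1) + (d + 1) * a * n ^ d := by
  induction d with
  | zero => simp; omega
  | succ d ih =>
    have h1 : n ≤ (n - a) + a := by omega
    have h2 : (n - a) ^ (d + 1) ≤ n ^ (d + 1) := Nat.pow_le_pow_left (Nat.sub_le _ _) _
    calc n ^ (d + 1 + 1) = n ^ (d + 1) * n := pow_succ _ _
      _ ≤ ((n - a) ^ (d + 1) + (d + 1) * a * n ^ d) * n := Nat.mul_le_mul_right _ ih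
      _ = (n - a) ^ (d + 1) * n + (d + 1) * a * n ^ (d + 1) := by ring
      _ ≤ (n - a) ^ (d + 1) * ((n - a) + a) + (d + 1) * a * n ^ (d + 1) := by gcongr
      _ = (n - a) ^ (d + 1 + 1) + (n - a) ^ (d + 1) * a + (d + 1) * a * n ^ (d + 1) := by ring
      _ ≤ (n - a) ^ (d + 1 + 1) + n ^ (d + 1) * a + (d + 1) * a * n ^ (d + 1) := by gcongr
      _ = _ := by ring

theorem pow_succ_le_factorial_mul_choose_add (n i d : ℕ) :
    n ^ (d + 1) ≤ (d + 1).factorial * (n - i).choose (d + 1) +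
      (d + 1) * (i + d + 1) * n ^ d := by
  refine (pow_succ_le_sub_pow_add n (i + d + 1) d).trans (Nat.add_le_add_right ?_ _)
  rw [← Nat.descFactorial_eq_factorial_mul_choose]
  exact (Nat.pow_le_pow_left (by omega) _).trans (Nat.pow_sub_le_descFactorial _ _)

theorem factorial_mul_choose_le_pow (n d : ℕ) : d.factorial * n.choose d ≤ n ^ d := by
  rw [← Nat.descFactorial_eq_factorial_mul_choose]
  exact Nat.descFactorial_le_pow _ _

/-- A power sum that is almost as large as possible is dominated by one of the parts. -/
theorem exists_large_part {ι : Type*} {s : Finset ι} {m : ι → ℕ} {m₀ n q d : ℕ} (hn : 1 ≤ n)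
    (hq : 2 ≤ q) (hm : ∑ i ∈ s, m i + m₀ = n)
    (h : 2 * q * n ^ (d + 2) ≤ 2 * q * ∑ i ∈ s, m i ^ (d + 2) + q * m₀ ^ (d + 2) + n ^ (d + 2)) :
    ∃ i ∈ s, 2 * q * (n - m i) ≤ n := by
  obtain ⟨M, hM, hMs⟩ : ∃ M, (∀ i ∈ s, m i ≤ M) ∧ (M = 0 ∨ ∃ i ∈ s, m i = M) := by
    refine ⟨s.sup m, fun i hi => Finset.le_sup hi, ?_⟩
    rcases s.eq_empty_or_nonempty with rfl | hne
    · left; simp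
    · right
      obtain ⟨i, hi, h⟩ := Finset.exists_mem_eq_sup s hne m
      exact ⟨i, hi, h.symm⟩
  have hle : ∀ i ∈ s, m i ≤ n := fun i hi =>
    (Finset.single_le_sum (fun _ _ => Nat.zero_le _) hi).trans (by omega)
  have hMn : M + m₀ ≤ n := by
    rcases hMs with rfl | ⟨i, hi, rfl⟩
    · omega
    · have := Finset.single_le_sum (f := m) (fun _ _ => Nat.zero_le _) hi
      omega
  have hsum : ∑ i ∈ s, m i ^ (d + 2) ≤ (n - m₀) * M * n ^ d := by
    calc ∑ i ∈ s, m i ^ (d + 2) ≤ ∑ i ∈ s, m i * (M * n ^ d) := by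
          refine Finset.sum_le_sum fun i hi => ?_
          calc m i ^ (d + 2) = m i * (m i * m i ^ d) := by ring
            _ ≤ m i * (M * n ^ d) := by
              gcongr
              exacts [hM i hi, hle i hi]
      _ = (n - m₀) * M * n ^ d := by
          rw [← Finset.sum_mul, ← hm, Nat.add_sub_cancel, mul_assoc]
  have hm₀ : m₀ ^ (d + 2) ≤ m₀ * n * n ^ d := by
    calc m₀ ^ (d + 2) = m₀ * m₀ * m₀ ^ d := by ring
      _ ≤ m₀ * n * n ^ d := by gcongr <;> omega
  have hquad : 2 * q * n ^ 2 ≤ 2 * q * ((n - m₀) * M) + q * (m₀ * n) + n ^ 2 := by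
    refine Nat.le_of_mul_le_mul_right ?_ (pow_pos hn d)
    calc 2 * q * n ^ 2 * n ^ d = 2 * q * n ^ (d + 2) := by ring
      _ ≤ _ := h
      _ ≤ 2 * q * ((n - m₀) * M * n ^ d) + q * (m₀ * n * n ^ d) + n ^ (d + 2) := by gcongr
      _ = _ := by ring
  obtain ⟨b, rfl⟩ : ∃ b, n = m₀ + b := ⟨n - m₀, by omega⟩
  rw [Nat.add_sub_cancel_left] at hquad
  have hMb : M ≤ b := by omega
  by_cases h2 : m₀ + b ≤ 2 * M
  · rcases hMs with h0 | ⟨i, hi, hiM⟩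
    · omega
    refine ⟨i, hi, ?_⟩
    rw [hiM]
    obtain ⟨c, rfl⟩ : ∃ c, b = M + c := ⟨b - M, by omega⟩
    rw [show m₀ + (M + c) - M = m₀ + c by omega]
    refine Nat.le_of_mul_le_mul_right (c := m₀ + (M + c)) ?_ (by omega)
    nlinarith [Nat.mul_le_mul_left (q * m₀) h2]
  · exfalso
    push Not at h2
    have h3 : 2 * (b * M) + m₀ * (m₀ + b) ≤ (m₀ + b) ^ 2 := by
      obtain ⟨c, rfl⟩ : ∃ c, b = M + c := ⟨b - M, by omega⟩
      nlinarith [Nat.zero_le (M * c), Nat.zero_le (m₀ * c), Nat.zero_le (c * c),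
        mul_le_mul_of_nonneg_left (show M ≤ m₀ + c by omega) (Nat.zero_le (M + c))]
    have h4 : 0 < (m₀ + b) ^ 2 := by positivity
    nlinarith [Nat.mul_le_mul_left q h3]

/-- In a dense hypergraph without long linear chains, some `t`-set has a core covering all but a
small proportion of the vertices. -/
theorem exists_dominant_linkCore {j t N K q : ℕ} (ht : 1 ≤ t) (hN : 1 ≤ N) (hq : 2 ≤ q)
    (hNk : (2 * t + 2) * (j + 3) ≤ N) (hK : (2 * t + 2) * (j + 3) + t ≤ K) :
    ∃ n₀ : ℕ, ∀ (V : Type*) [DecidableEq V] [Fintype V] (H : Finset (Finset V)),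
      n₀ ≤ Fintype.card V → (∀ e ∈ H, e.card = j + 3) →
      (∀ U x, ¬ LinearChain H (2 * t + 1) U x) →
      ∑ i ∈ Finset.Icc 1 t, (Fintype.card V - i).choose (j + 2) ≤ H.card →
      ∃ A : Finset V, A.card = t ∧
        K < (linkCore H A (j + 2) (K * Fintype.card V ^ j)).card ∧
        2 * q * (Fintype.card V - (linkCore H A (j + 2) (K * Fintype.card V ^ j)).card) ≤
          Fintype.card V := by
  obtain ⟨f, hf⟩ : ∃ f, f = (j + 2).factorial := ⟨_, rfl⟩
  have hf0 : 0 < f := hf ▸ Nat.factorial_pos _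
  obtain ⟨T, hT⟩ : ∃ T, T = 4 * f * N * q := ⟨_, rfl⟩
  obtain ⟨ℓ, hℓ⟩ : ∃ ℓ, ℓ = T * N := ⟨_, rfl⟩
  obtain ⟨c₀, hc₀⟩ : ∃ c, c = t * ((j + 2) * (t + j + 2)) := ⟨_, rfl⟩
  obtain ⟨c₁, hc₁⟩ : ∃ c, c = ℓ ^ 2 + ℓ * (2 ^ ℓ * (K + K ^ (j + 2))) := ⟨_, rfl⟩
  obtain ⟨c₂, hc₂⟩ : ∃ c, c = 4 * f * (N + 1) ^ 3 := ⟨_, rfl⟩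
  refine ⟨2 * q * c₂ + 4 * q * (f * c₁ + c₀) + 1, fun V _ _ H hn hk hfree hH => ?_⟩
  obtain ⟨n, hnV⟩ : ∃ n, n = Fintype.card V := ⟨_, rfl⟩
  obtain ⟨r, F, hE⟩ := exists_isElimination hk (N := N) (by simpa [add_assoc] using hNk) hfree
  have hpopular := hE.card_popular_le T
  set L := Finset.univ.filter fun w =>
    Fintype.card V < T * (Finset.univ.filter (w ∈ F ·)).card with hL
  rw [← hℓ] at hpopular
  have hV : 1 ≤ Fintype.card V := by omega
  have hcount := card_le_sum_neighbors hk L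
  have hsum := sum_neighbors_le hk hfree hK ht hV hpopular
  rw [← hnV] at hn hH hV hcount hsum ⊢
  set core : Finset V → Finset V := fun A => linkCore H A (j + 2) (K * n ^ j) with hcore
  set 𝒜 := (Finset.powersetCard t L).filter fun A => K < (core A).card with h𝒜
  have hmem : ∀ A ∈ 𝒜, A ⊆ L ∧ A.card = t ∧ K < (core A).card := by
    intro A hA
    rw [h𝒜, Finset.mem_filter, Finset.mem_powersetCard] at hA
    exact ⟨hA.1.1, hA.1.2, hA.2⟩
  set Y := Finset.univ \ 𝒜.biUnion core with hY
  have hpart : ∑ A ∈ 𝒜, (core A).card + Y.card = n := by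
    rw [← Finset.card_biUnion, hY, Finset.card_sdiff_of_subset (Finset.subset_univ _),
      Finset.card_univ, ← hnV]
    · have := Finset.card_le_univ (𝒜.biUnion core)
      omega
    · intro A hA A' hA' hne
      have := disjoint_linkCore hk hfree hK (hmem A hA).2.1 (hmem A' hA').2.1 hne
      rw [← hnV] at this
      exact this (hmem A hA).2.2
  have hunpop := hE.card_unpopular_le (T := T) (B := H.filter (Disjoint · L)) (Y := Y)
    (Finset.filter_subset _ _) hk (by
      intro e he
      rw [Finset.mem_filter] at he
      rw [hY, Finset.subset_sdiff, Finset.disjoint_biUnion_right]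
      refine ⟨Finset.subset_univ _, fun A hA => ?_⟩
      have := disjoint_linkCore_of_disjoint hk hfree hK (hmem A hA).2.1 (e := e)
      rw [← hnV] at this
      exact this (hmem A hA).2.2 he.1 (he.2.mono_right (hmem A hA).1)) (by
      intro e he w hw
      by_contra! hcon
      exact Finset.disjoint_left.1 (Finset.mem_filter.1 he).2 hw
        (Finset.mem_filter.2 ⟨Finset.mem_univ _, hcon⟩))
  rw [← hnV, ← hf, ← hc₂] at hunpop
  set b := (H.filter (Disjoint · L)).card
  have hb : 4 * q * (f * b) ≤ 2 * q * Y.card ^ (j + 2) + n ^ (j + 2) + 2 * q * c₂ * n ^ (j + 1) := by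
    refine Nat.le_of_mul_le_mul_left (c := 2 * f * N) ?_ (by positivity)
    calc _ = 2 * f * (T * b) := by rw [hT]; ring
      _ ≤ _ := hunpop
      _ = _ := by rw [hT]; ring
  have hlow : t * n ^ (j + 2) ≤ f * H.card + c₀ * n ^ (j + 1) := by
    calc t * n ^ (j + 2) = ∑ i ∈ Finset.Icc 1 t, n ^ (j + 2) := by simp
      _ ≤ ∑ i ∈ Finset.Icc 1 t, (f * (n - i).choose (j + 2) +
            (j + 2) * (t + j + 2) * n ^ (j + 1)) := by
          refine Finset.sum_le_sum fun i hi => ?_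
          refine (pow_succ_le_factorial_mul_choose_add n i (j + 1)).trans ?_
          rw [hf, show i + (j + 1) + 1 = i + j + 2 by ring]
          gcongr
          exact (Finset.mem_Icc.1 hi).2
      _ = f * ∑ i ∈ Finset.Icc 1 t, (n - i).choose (j + 2) + c₀ * n ^ (j + 1) := by
          rw [Finset.sum_add_distrib, ← Finset.mul_sum, hc₀]
          simp [mul_assoc]
      _ ≤ _ := by gcongr
  have hup : f * H.card ≤ f * b + (t - 1) * n ^ (j + 2) + ∑ A ∈ 𝒜, (core A).card ^ (j + 2) +
      f * c₁ * n ^ (j + 1) := by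
    have h1 : H.card ≤ b + (t - 1) * n.choose (j + 2) +
        ∑ A ∈ 𝒜, (core A).card.choose (j + 2) + c₁ * n ^ (j + 1) := by
      have h2 : L.card ^ 2 * n ^ (j + 1) ≤ ℓ ^ 2 * n ^ (j + 1) := by gcongr
      calc H.card ≤ b + ℓ ^ 2 * n ^ (j + 1) + ((t - 1) * n.choose (j + 2) +
            ∑ A ∈ 𝒜, (core A).card.choose (j + 2) +
              ℓ * (2 ^ ℓ * (K + K ^ (j + 2)) * n ^ (j + 1))) :=
            hcount.trans (add_le_add (add_le_add le_rfl h2) hsum)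
        _ = _ := by rw [hc₁]; ring
    calc f * H.card ≤ f * (b + (t - 1) * n.choose (j + 2) +
        ∑ A ∈ 𝒜, (core A).card.choose (j + 2) + c₁ * n ^ (j + 1)) := Nat.mul_le_mul_left _ h1
      _ = f * b + (t - 1) * (f * n.choose (j + 2)) +
        ∑ A ∈ 𝒜, f * (core A).card.choose (j + 2) + f * c₁ * n ^ (j + 1) := by
          rw [← Finset.mul_sum]; ring
      _ ≤ _ := by
          rw [hf]
          gcongr
          · exact factorial_mul_choose_le_pow _ _
          · exact factorial_mul_choose_le_pow _ _
  have hmain : n ^ (j + 2) ≤ f * b + ∑ A ∈ 𝒜, (core A).card ^ (j + 2) +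
      (f * c₁ + c₀) * n ^ (j + 1) := by
    obtain ⟨s, rfl⟩ : ∃ s, t = s + 1 := ⟨t - 1, by omega⟩
    rw [Nat.add_sub_cancel] at hup
    linarith
  have hsmall : (2 * q * c₂ + 4 * q * (f * c₁ + c₀)) * n ^ (j + 1) ≤ n ^ (j + 2) := by
    rw [pow_succ n (j + 1), mul_comm (n ^ (j + 1)) n]
    gcongr
    omega
  obtain ⟨A, hA, hAn⟩ := exists_large_part (by omega) hq hpart (d := j) (by
    have := Nat.mul_le_mul_left (4 * q) hmain
    linarith)
  exact ⟨A, (hmem A hA).2.1, (hmem A hA).2.2, hAn⟩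

theorem choose_eq_choose_sub_add_sum {n t : ℕ} (d : ℕ) (h : t ≤ n) :
    n.choose (d + 1) = (n - t).choose (d + 1) + ∑ i ∈ Finset.Icc 1 t, (n - i).choose d := by
  induction t with
  | zero => simp
  | succ t ih =>
    rw [Finset.sum_Icc_succ_top (by omega), ih (by omega),
      show n - t = n - (t + 1) + 1 by omega, Nat.choose_succ_succ]
    ring

section Comparison

variable {V : Type*} [DecidableEq V] [Fintype V] {H : Finset (Finset V)} {A : Finset V}

/-- The number of `(d + 1)`-sets meeting `A`. -/
theorem card_powersetCard_filter_not_disjoint (A : Finset V) (d : ℕ) :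
    ((Finset.powersetCard (d + 1) Finset.univ).filter fun e => ¬ Disjoint e A).card =
      ∑ i ∈ Finset.Icc 1 A.card, (Fintype.card V - i).choose d := by
  have h := Finset.card_filter_add_card_filter_not (s := Finset.powersetCard (d + 1) Finset.univ)
    (fun e => Disjoint e A)
  have h2 : (Finset.powersetCard (d + 1) Finset.univ).filter (fun e => Disjoint e A) =
      Finset.powersetCard (d + 1) (Finset.univ \ A) := by
    ext e
    simp only [Finset.mem_filter, Finset.mem_powersetCard, Finset.subset_sdiff]
    tauto
  rw [h2, Finset.card_powersetCard, Finset.card_powersetCard,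
    Finset.card_sdiff_of_subset (Finset.subset_univ _), Finset.card_univ,
    choose_eq_choose_sub_add_sum d (Finset.card_le_univ A)] at h
  omega

theorem choose_le_card_missing {j D : ℕ} {x : V} (hxA : x ∉ A)
    (hx : ((commonLink H A (j + 2)).filter (x ∈ ·)).card ≤ D) :
    (Fintype.card V - (A.card + 1)).choose (j + 1) ≤
      (((Finset.powersetCard (j + 3) Finset.univ).filter
        fun e => ¬ Disjoint e A ∧ e ∉ H).filter (x ∈ ·)).card + D := by
  set P := (Finset.powersetCard (j + 1) ((Finset.univ \ A).erase x)).image (insert x) with hP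
  set Q := ((Finset.powersetCard (j + 3) Finset.univ).filter
    fun e => ¬ Disjoint e A ∧ e ∉ H).filter (x ∈ ·) with hQ
  have hPcard : P.card = (Fintype.card V - (A.card + 1)).choose (j + 1) := by
    rw [hP, Finset.card_image_of_injOn, Finset.card_powersetCard, Finset.card_erase_of_mem,
      Finset.card_sdiff_of_subset (Finset.subset_univ _), Finset.card_univ, Nat.sub_sub]
    · simpa using hxA
    · intro p hp p' hp' h
      rw [Finset.mem_coe, Finset.mem_powersetCard, Finset.subset_erase] at hp hp'
      rw [← Finset.erase_insert hp.1.2, ← Finset.erase_insert hp'.1.2]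
      exact congrArg (Finset.erase · x) h
  rw [← hPcard]
  have hsub : P ⊆ Q.image (· \ A) ∪ (commonLink H A (j + 2)).filter (x ∈ ·) := by
    intro p hp
    obtain ⟨p', hp', rfl⟩ := Finset.mem_image.1 hp
    rw [Finset.mem_powersetCard, Finset.subset_erase, Finset.subset_sdiff] at hp'
    have hdisj : Disjoint (insert x p') A := Finset.disjoint_insert_left.2 ⟨hxA, hp'.1.1.2⟩
    have hcard : (insert x p').card = j + 2 := by
      rw [Finset.card_insert_of_notMem hp'.1.2, hp'.2]
    by_cases hall : ∀ s ∈ A, insert s (insert x p') ∈ H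
    · refine Finset.mem_union_right _ (Finset.mem_filter.2 ⟨mem_commonLink.2 ⟨hcard, hdisj, hall⟩,
        Finset.mem_insert_self _ _⟩)
    · push Not at hall
      obtain ⟨s, hs, hsH⟩ := hall
      have hsp : s ∉ insert x p' := fun h => Finset.disjoint_left.1 hdisj h hs
      refine Finset.mem_union_left _ (Finset.mem_image.2 ⟨insert s (insert x p'), ?_, ?_⟩)
      · simp only [hQ, Finset.mem_filter, Finset.mem_powersetCard, Finset.subset_univ, true_and]
        refine ⟨⟨by rw [Finset.card_insert_of_notMem hsp, hcard], ?_, hsH⟩, by simp⟩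
        exact Finset.not_disjoint_iff.2 ⟨s, Finset.mem_insert_self _ _, hs⟩
      · rw [Finset.insert_sdiff_of_mem _ hs, Finset.sdiff_eq_self_of_disjoint hdisj]
  calc P.card ≤ _ := Finset.card_le_card hsub
    _ ≤ _ := Finset.card_union_le _ _
    _ ≤ _ := add_le_add Finset.card_image_le hx

theorem card_mul_choose_le_card_missing {j D : ℕ} {W : Finset V} (hWA : Disjoint W A)
    (hW : ∀ x ∈ W, ((commonLink H A (j + 2)).filter (x ∈ ·)).card ≤ D) :
    W.card * (Fintype.card V - (A.card + 1)).choose (j + 1) ≤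
      (j + 3) * ((Finset.powersetCard (j + 3) Finset.univ).filter
        fun e => ¬ Disjoint e A ∧ e ∉ H).card + W.card * D := by
  set Q := (Finset.powersetCard (j + 3) Finset.univ).filter fun e => ¬ Disjoint e A ∧ e ∉ H
  have h1 : ∑ x ∈ W, (Q.filter (x ∈ ·)).card = ∑ e ∈ Q, (W.filter (· ∈ e)).card :=
    Finset.sum_card_bipartiteAbove_eq_sum_card_bipartiteBelow _
  have h2 : ∑ e ∈ Q, (W.filter (· ∈ e)).card ≤ ∑ _e ∈ Q, (j + 3) := by
    refine Finset.sum_le_sum fun e he => ?_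
    rw [← (Finset.mem_powersetCard.1 (Finset.mem_filter.1 he).1).2]
    exact Finset.card_le_card fun x hx => (Finset.mem_filter.1 hx).2
  calc W.card * (Fintype.card V - (A.card + 1)).choose (j + 1)
      = ∑ _x ∈ W, (Fintype.card V - (A.card + 1)).choose (j + 1) := by simp
    _ ≤ ∑ x ∈ W, ((Q.filter (x ∈ ·)).card + D) := Finset.sum_le_sum fun x hx =>
        choose_le_card_missing (Finset.disjoint_left.1 hWA hx) (hW x hx)
    _ = ∑ e ∈ Q, (W.filter (· ∈ e)).card + W.card * D := by
        rw [Finset.sum_add_distrib, h1]; simp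
    _ ≤ ∑ _e ∈ Q, (j + 3) + W.card * D := by gcongr
    _ = _ := by simp [mul_comm]

/-- A hypergraph without long linear chains and with a dominant core is no larger than the family of
all sets meeting `A`. -/
theorem card_le_of_dominant_linkCore {j t N K : ℕ} (hNk : (2 * t + 2) * (j + 3) ≤ N)
    (hK : (2 * t + 2) * (j + 3) + t ≤ K)
    (hn : 2 * ((j + 1).factorial * K + (j + 1) * (t + 1 + j + 1)) ≤ Fintype.card V)
    (hk : ∀ e ∈ H, e.card = j + 3) (hfree : ∀ U x, ¬ LinearChain H (2 * t + 1) U x)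
    (hA : A.card = t) (hrich : K < (linkCore H A (j + 2) (K * Fintype.card V ^ j)).card)
    (hdom : 2 * ((j + 1).factorial * (j + 3) * N) *
      (Fintype.card V - (linkCore H A (j + 2) (K * Fintype.card V ^ j)).card) ≤ Fintype.card V) :
    H.card ≤ ∑ i ∈ Finset.Icc 1 t, (Fintype.card V - i).choose (j + 2) := by
  obtain ⟨r, F, hE⟩ := exists_isElimination hk (N := N) (by simpa [add_assoc] using hNk) hfree
  set n := Fintype.card V with hnV
  set core := linkCore H A (j + 2) (K * n ^ j) with hcore
  set B := H.filter (Disjoint · A) with hB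
  set M := (Finset.powersetCard (j + 3) Finset.univ).filter fun e => ¬ Disjoint e A ∧ e ∉ H with hM
  set W := (Finset.univ \ A) \ core with hW
  set g := (j + 1).factorial with hg
  have hg0 : 0 < g := Nat.factorial_pos _
  have hWn : W.card ≤ n - core.card := by
    rw [hnV, ← Finset.card_univ, ← Finset.card_sdiff_of_subset (Finset.subset_univ core)]
    exact Finset.card_le_card (Finset.sdiff_subset_sdiff (Finset.subset_univ _) le_rfl)
  have hWn' : W.card ≤ n := hWn.trans (Nat.sub_le _ _)
  have hBW : B.card ≤ N * W.card ^ (j + 2) := by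
    refine hE.card_le_mul_pow (k := j + 1) (Finset.filter_subset _ _) hk fun e he => ?_
    rw [hB, Finset.mem_filter] at he
    rw [hW, Finset.subset_sdiff, Finset.subset_sdiff]
    exact ⟨⟨e.subset_univ, he.2⟩, disjoint_linkCore_of_disjoint hk hfree hK hA hrich he.1 he.2⟩
  have hWM := card_mul_choose_le_card_missing (A := A) (D := K * n ^ j) (W := W)
    (Finset.sdiff_disjoint.mono_left Finset.sdiff_subset) (by
      intro x hx
      rw [hW, Finset.mem_sdiff] at hx
      by_contra! hcon
      exact hx.2 (Finset.mem_filter.2 ⟨hx.1, hcon⟩))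
  rw [← hM, ← hnV, hA] at hWM
  have hchoose : (j + 3) * N * W.card ^ (j + 1) + K * n ^ j ≤ (n - (t + 1)).choose (j + 1) := by
    have h1 := pow_succ_le_factorial_mul_choose_add n (t + 1) j
    rw [← hg] at h1
    have h2 : 2 * (g * (j + 3) * N) * W.card ≤ n := (Nat.mul_le_mul_left _ hWn).trans hdom
    have h3 : W.card ^ (j + 1) ≤ W.card * n ^ j := by
      rw [pow_succ']
      gcongr
    have h4 := Nat.mul_le_mul_right (n ^ j) h2
    have h5 := Nat.mul_le_mul_right (n ^ j) hn
    have h6 := Nat.mul_le_mul_left (2 * (g * (j + 3) * N)) h3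
    refine Nat.le_of_mul_le_mul_left (c := 2 * g) ?_ (by positivity)
    rw [pow_succ' n j] at h1
    linarith
  have hBM : B.card ≤ M.card := by
    refine Nat.le_of_mul_le_mul_left (c := j + 3) ?_ (by omega)
    have h1 := Nat.mul_le_mul_left W.card hchoose
    have h2 := Nat.mul_le_mul_left (j + 3) hBW
    have h3 : (j + 3) * (N * W.card ^ (j + 2)) = W.card * ((j + 3) * N * W.card ^ (j + 1)) := by
      ring
    linarith
  have htotal : (H.filter fun e => ¬ Disjoint e A).card + M.card =
      ∑ i ∈ Finset.Icc 1 t, (n - i).choose (j + 2) := by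
    rw [← hA, ← card_powersetCard_filter_not_disjoint, ← Finset.card_union_of_disjoint]
    · congr 1
      ext e
      have := hk e
      simp only [hM, Finset.mem_union, Finset.mem_filter, Finset.mem_powersetCard,
        Finset.subset_univ, true_and]
      tauto
    · rw [Finset.disjoint_left]
      intro e he he'
      exact (Finset.mem_filter.1 he').2.2 (Finset.mem_filter.1 he).1
  rw [← htotal, ← Finset.card_filter_add_card_filter_not (s := H) (fun e => Disjoint e A), add_comm]
  exact Nat.add_le_add_left hBM _

end Comparison

/-- The extremal bound for hypergraphs without linear chains. -/
theorem exists_card_le_of_not_linearChain (j : ℕ) {t : ℕ} (ht : 1 ≤ t) :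
    ∃ n₀ : ℕ, ∀ (V : Type*) [DecidableEq V] [Fintype V] (H : Finset (Finset V)),
      n₀ ≤ Fintype.card V → (∀ e ∈ H, e.card = j + 3) →
      (∀ U x, ¬ LinearChain H (2 * t + 1) U x) →
      H.card ≤ ∑ i ∈ Finset.Icc 1 t, (Fintype.card V - i).choose (j + 2) := by
  set N := (2 * t + 2) * (j + 3) with hN
  have hN2 : 2 ≤ N := by nlinarith
  have hq : 2 ≤ (j + 1).factorial * (j + 3) * N := by
    have := Nat.factorial_pos (j + 1)
    exact hN2.trans (Nat.le_mul_of_pos_left _ (by positivity))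
  obtain ⟨n₁, h₁⟩ := exists_dominant_linkCore (K := N + t) ht (by omega) hq hN.ge le_rfl
  refine ⟨max n₁ (2 * ((j + 1).factorial * (N + t) + (j + 1) * (t + 1 + j + 1))),
    fun V _ _ H hn hk hfree => ?_⟩
  by_contra! hcon
  obtain ⟨A, hA, hrich, hdom⟩ := h₁ V H ((le_max_left _ _).trans hn) hk hfree hcon.le
  exact hcon.not_ge (card_le_of_dominant_linkCore hN.ge le_rfl ((le_max_right _ _).trans hn) hk
    hfree hA hrich hdom)

/-- A linear path of `2 t + 1` edges cannot have all its edges meet a set of `t` vertices. -/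
theorem IsLinearPath.exists_disjoint {n k t : ℕ} {A : Fin (2 * t + 1) → Finset (Fin n)}
    (hA : IsLinearPath k (2 * t + 1) A) {S : Finset (Fin n)} (hS : S.card ≤ t) :
    ∃ i, Disjoint (A i) S := by
  by_contra! hcon
  choose x hxA hxS using fun i => Finset.not_disjoint_iff.1 (hcon i)
  let φ : Fin (t + 1) → Fin (2 * t + 1) := fun i => ⟨2 * i, by omega⟩
  have hinj : Function.Injective fun i => x (φ i) := by
    intro a b hab
    by_contra hne
    wlog hlt : a < b generalizing a b
    · exact this hab.symm (Ne.symm hne) (lt_of_le_of_ne (not_lt.1 hlt) (Ne.symm hne))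
    have hd := hA.2.2 (φ a) (φ b) (by
      simp only [φ]
      have : (a : ℕ) < b := hlt
      omega)
    refine Finset.disjoint_left.1 hd (hxA _) ?_
    have hab' : x (φ a) = x (φ b) := hab
    rw [hab']
    exact hxA _
  have := Finset.card_le_card_of_injOn (s := Finset.univ) (t := S) (fun i => x (φ i))
    (fun i _ => hxS _) hinj.injOn
  rw [Finset.card_univ, Fintype.card_fin] at this
  omega

/-- Theorem 1, odd case: for `k ≥ 3` and sufficiently large `n`, the Turán number of the `k`-uniform linear path of length `2t+1` is `C(n-1,k-1) + ⋯ + C(n-t,k-1)`. -/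
theorem turan_linear_path_odd (k t : ℕ) (hk : 3 ≤ k) (ht : 1 ≤ t) :
    ∃ n₀ : ℕ, ∀ n ≥ n₀,
      IsGreatest {m : ℕ | ∃ H : Finset (Finset (Fin n)),
          (∀ e ∈ H, e.card = k) ∧
          (¬ ∃ A : Fin (2 * t + 1) → Finset (Fin n),
              IsLinearPath k (2 * t + 1) A ∧ ∀ i, A i ∈ H) ∧
          H.card = m}
        (∑ i ∈ Finset.Icc 1 t, Nat.choose (n - i) (k - 1)) := by

  obtain ⟨j, rfl⟩ : ∃ j, k = j + 3 := ⟨k - 3, by omega⟩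
  obtain ⟨n₀, h₀⟩ := exists_card_le_of_not_linearChain.{0} j ht
  refine ⟨max n₀ t, fun n hn => ⟨?_, ?_⟩⟩
  · obtain ⟨S, -, hS⟩ := Finset.exists_subset_card_eq
      (s := (Finset.univ : Finset (Fin n))) (n := t)
      (by rw [Finset.card_univ, Fintype.card_fin]; exact (le_max_right _ _).trans hn)
    refine ⟨(Finset.powersetCard (j + 3) Finset.univ).filter fun e => ¬ Disjoint e S,
      fun e he => (Finset.mem_powersetCard.1 (Finset.mem_filter.1 he).1).2, ?_, ?_⟩
    · rintro ⟨A, hA, hAH⟩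
      obtain ⟨i, hi⟩ := hA.exists_disjoint hS.le
      exact (Finset.mem_filter.1 (hAH i)).2 hi
    · rw [card_powersetCard_filter_not_disjoint, hS, Fintype.card_fin]
      rfl
  · rintro m ⟨H, hk, hfree, rfl⟩
    have := h₀ (Fin n) H (by rw [Fintype.card_fin]; exact (le_max_left _ _).trans hn) hk
      fun U x hc => by
        obtain ⟨A, hA, hAH, -⟩ := hc.exists_isLinearPath hk
        exact hfree ⟨A, hA, hAH⟩
    rw [Fintype.card_fin] at this
    exact this
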